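/- arXiv:math/0008003 — 9 statements merged into one kernel-verified Lean document; each statement's English description precedes it below -/
import Mathlib

section
/- For every ε > 0 there exists ν > 0 with the following property: for every unital AF C*-algebra A, every unitary u ∈ A and every self-adjoint h ∈ A with ‖hu − uh‖ < ν, there is a continuous path (u_t)_{t∈[0,1]} of unitaries in A such that u_0 = 1, u_1 = u, ‖hu_t − u_t h‖ < ε for all t ∈ [0,1], and the path is rectifiable with length (total variation of t ↦ u_t in the norm of A) at most 3π + ε. The constant ν depends only on ε and not on A, u, or h. -/
/-- A unital C*-algebra is AF if there is an increasing sequence of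
finite-dimensional *-subalgebras (each containing the unit, which is automatic
for `StarSubalgebra`s) whose union is dense. -/
def IsAFAlgebra (A : Type*) [CStarAlgebra A] : Prop :=
  ∃ S : ℕ → StarSubalgebra ℂ A,
    Monotone S ∧ (∀ n, FiniteDimensional ℂ (S n)) ∧ Dense (⋃ n, (S n : Set A))

section Unitary

variable {A : Type*} [CStarAlgebra A]

lemma norm_le_one_of_mem_unitary {u : A} (hu : u ∈ unitary A) : ‖u‖ ≤ 1 := by
  rcases subsingleton_or_nontrivial A with _ | _
  · simp [Subsingleton.elim u 0]
  · exact (CStarRing.norm_of_mem_unitary hu).le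

lemma norm_le_one_of_isStarProjection {p : A} (hp : IsStarProjection p) : ‖p‖ ≤ 1 := by
  have h1 : ‖p‖ * ‖p‖ = ‖p‖ := by
    rw [← CStarRing.norm_star_mul_self, hp.isSelfAdjoint.star_eq, hp.isIdempotentElem.eq]
  nlinarith [norm_nonneg p]

lemma norm_commutator_star (h x : A) (hh : IsSelfAdjoint h) :
    ‖h * star x - star x * h‖ = ‖h * x - x * h‖ := by
  rw [← norm_star, ← norm_neg]
  simp [hh.star_eq]

lemma norm_commutator_mul_le (h x y : A) (hx : ‖x‖ ≤ 1) (hy : ‖y‖ ≤ 1) :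
    ‖h * (x * y) - (x * y) * h‖ ≤ ‖h * x - x * h‖ + ‖h * y - y * h‖ := by
  have : h * (x * y) - (x * y) * h = (h * x - x * h) * y + x * (h * y - y * h) := by noncomm_ring
  rw [this]
  refine (norm_add_le _ _).trans (add_le_add ?_ ?_)
  · exact (norm_mul_le _ _).trans (mul_le_of_le_one_right (norm_nonneg _) hy)
  · exact (norm_mul_le _ _).trans (mul_le_of_le_one_left (norm_nonneg _) hx)

lemma norm_commutator_le (h x : A) (hx : ‖x‖ ≤ 1) : ‖h * x - x * h‖ ≤ 2 * ‖h‖ := by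
  have h1 : ‖h * x‖ ≤ ‖h‖ := (norm_mul_le _ _).trans (mul_le_of_le_one_right (norm_nonneg _) hx)
  have h2 : ‖x * h‖ ≤ ‖h‖ := (norm_mul_le _ _).trans (mul_le_of_le_one_left (norm_nonneg _) hx)
  linarith [norm_sub_le (h * x) (x * h)]

/-- The unitary part of the polar decomposition of an invertible element. -/
lemma exists_polar_of_isUnit {z : A} (hz : IsUnit z) :
    ∃ s : A, z * s ∈ unitary A ∧ (∀ c, Commute (star z * z) c → Commute s c) ∧
      ‖z * s - z‖ ≤ ‖1 - star z * z‖ := by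
  set a := star z * z with ha
  have hsa : IsSelfAdjoint a := .star_mul_self z
  have hpos : ∀ x ∈ spectrum ℝ a, 0 < x := fun x hx =>
    lt_of_le_of_ne (spectrum_star_mul_self_nonneg x hx) (by
      rintro rfl
      exact (spectrum.zero_notMem_iff ℝ).2 (hz.star.mul hz) hx)
  have hc : ContinuousOn (fun r : ℝ => (√r)⁻¹) (spectrum ℝ a) :=
    Real.continuous_sqrt.continuousOn.inv₀ fun x hx => (Real.sqrt_pos.2 (hpos x hx)).ne'
  have hc2 : ContinuousOn (fun r : ℝ => √r) (spectrum ℝ a) := Real.continuous_sqrt.continuousOn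
  set s := cfc (fun r : ℝ => (√r)⁻¹) a with hs
  set t := cfc (fun r : ℝ => √r) a with ht
  have hst : s * t = 1 := by
    rw [hs, ht, ← cfc_mul _ _ a hc hc2, ← cfc_one ℝ a]
    exact cfc_congr fun x hx => inv_mul_cancel₀ (Real.sqrt_pos.2 (hpos x hx)).ne'
  have hts : t * s = 1 := by
    rw [hs, ht, ← cfc_mul _ _ a hc2 hc, ← cfc_one ℝ a]
    exact cfc_congr fun x hx => mul_inv_cancel₀ (Real.sqrt_pos.2 (hpos x hx)).ne'
  have htt : t * t = a := by
    rw [ht, ← cfc_mul _ _ a hc2 hc2]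
    refine Eq.trans ?_ (cfc_id ℝ a)
    exact cfc_congr fun x hx => Real.mul_self_sqrt (hpos x hx).le
  have hss : star s = s := (cfc_predicate (p := IsSelfAdjoint) _ a).star_eq
  have h1 : star (z * s) * (z * s) = 1 := by
    rw [star_mul, hss]
    calc s * star z * (z * s) = s * a * s := by rw [ha]; noncomm_ring
      _ = (s * t) * (t * s) := by rw [← htt]; noncomm_ring
      _ = 1 := by rw [hst, hts, one_mul]
  have hsu : IsUnit s := ⟨⟨s, t, hst, hts⟩, rfl⟩
  have hu : z * s ∈ unitary A := by
    refine Unitary.mem_iff.2 ⟨h1, ?_⟩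
    refine (hz.mul hsu).mul_right_cancel ?_
    rw [mul_assoc, h1, mul_one, one_mul]
  refine ⟨s, hu, fun c hc' => hc'.cfc_real _, ?_⟩
  have h2 : z * s - z = (z * s) * (1 - t) := by
    rw [mul_sub, mul_one, mul_assoc, hst, mul_one]
  rw [h2, CStarRing.norm_mem_unitary_mul _ hu]
  have h3 : 1 - t = cfc (fun r : ℝ => 1 - √r) a := by
    rw [cfc_sub (fun _ => (1 : ℝ)) _ a, cfc_const_one ℝ a]
  have h4 : 1 - a = cfc (fun r : ℝ => 1 - r) a := by
    rw [cfc_sub (fun _ => (1 : ℝ)) _ a, cfc_const_one ℝ a, cfc_id' ℝ a]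
  rw [h3]
  refine norm_cfc_le (norm_nonneg _) fun x hx => ?_
  rw [h4]
  refine le_trans ?_ (norm_apply_le_norm_cfc (fun r : ℝ => 1 - r) a hx)
  have hx0 := Real.sqrt_nonneg x
  have : 1 - x = (1 - √x) * (1 + √x) := by nlinarith [Real.mul_self_sqrt (hpos x hx).le]
  rw [this, norm_mul]
  refine le_mul_of_one_le_right (norm_nonneg _) ?_
  rw [Real.norm_of_nonneg (by positivity)]
  linarith

lemma isUnit_of_norm_sub_lt_one {u z : A} (hu : u ∈ unitary A) (h : ‖z - u‖ < 1) : IsUnit z := by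
  have h1 : ‖star u * (u - z)‖ < 1 := by
    rwa [CStarRing.norm_mem_unitary_mul _ (Unitary.star_mem hu), norm_sub_rev]
  have h2 := isUnit_one_sub_of_norm_lt_one h1
  have h3 : z = u * (1 - star u * (u - z)) := by
    rw [mul_sub, ← mul_assoc, (Unitary.mem_iff.1 hu).2]; simp
  rw [h3]
  exact IsUnit.mul ⟨⟨u, star u, (Unitary.mem_iff.1 hu).2, (Unitary.mem_iff.1 hu).1⟩, rfl⟩ h2

lemma norm_one_sub_star_mul_self_le {u z : A} {θ : ℝ} (hu : u ∈ unitary A) (h : ‖z - u‖ ≤ θ) :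
    ‖1 - star z * z‖ ≤ θ + θ + θ * θ := by
  have h0 : 0 ≤ θ := (norm_nonneg _).trans h
  have h1 : 1 - star z * z = -(star u * (z - u) + star (z - u) * u + star (z - u) * (z - u)) := by
    have : star u * u = 1 := (Unitary.mem_iff.1 hu).1
    simp only [star_sub, mul_sub, sub_mul, this]; noncomm_ring
  rw [h1, norm_neg]
  refine (norm_add_le _ _).trans (add_le_add ((norm_add_le _ _).trans (add_le_add ?_ ?_)) ?_)
  · rwa [CStarRing.norm_mem_unitary_mul _ (Unitary.star_mem hu)]
  · rwa [CStarRing.norm_mul_mem_unitary _ hu, norm_star]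
  · rw [CStarRing.norm_star_mul_self]
    gcongr

/-- The polar part of an element close to a unitary is close to that unitary. -/
lemma exists_polar_of_norm_sub_le {u z : A} {θ : ℝ} (hu : u ∈ unitary A) (h : ‖z - u‖ ≤ θ)
    (hθ : θ < 1) :
    ∃ s : A, z * s ∈ unitary A ∧ (∀ c, Commute (star z * z) c → Commute s c) ∧
      ‖z * s - u‖ ≤ 4 * θ := by
  obtain ⟨s, hs1, hs2, hs3⟩ := exists_polar_of_isUnit (isUnit_of_norm_sub_lt_one hu (h.trans_lt hθ))
  refine ⟨s, hs1, hs2, ?_⟩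
  have h0 : 0 ≤ θ := (norm_nonneg _).trans h
  have h2 := norm_one_sub_star_mul_self_le hu h
  have h3 : z * s - u = (z * s - z) + (z - u) := by abel
  rw [h3]
  refine (norm_add_le _ _).trans ?_
  nlinarith

/-- A `K`-Lipschitz path of unitaries parametrised by the unit interval. -/
structure IsUnitaryPath (K : ℝ) (p : ℝ → A) : Prop where
  mem_unitary : ∀ t ∈ Set.Icc (0 : ℝ) 1, p t ∈ unitary A
  norm_sub_le : ∀ s ∈ Set.Icc (0 : ℝ) 1, ∀ t ∈ Set.Icc (0 : ℝ) 1, ‖p s - p t‖ ≤ K * |s - t|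

lemma IsUnitaryPath.mul {K L : ℝ} {p q : ℝ → A} (hp : IsUnitaryPath K p)
    (hq : IsUnitaryPath L q) : IsUnitaryPath (K + L) (fun t => p t * q t) where
  mem_unitary t ht := mul_mem (hp.1 t ht) (hq.1 t ht)
  norm_sub_le s hs t ht := by
    have : p s * q s - p t * q t = (p s - p t) * q s + p t * (q s - q t) := by noncomm_ring
    rw [this, add_mul]
    refine (norm_add_le _ _).trans (add_le_add ?_ ?_)
    · rw [CStarRing.norm_mul_mem_unitary _ (hq.1 s hs)]; exact hp.2 s hs t ht
    · rw [CStarRing.norm_mem_unitary_mul _ (hp.1 t ht)]; exact hq.2 s hs t ht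

lemma isUnitaryPath_cfc {K : ℝ} (hK : 0 ≤ K) {w : A} (hw : w ∈ unitary A) (F : ℝ → ℂ → ℂ)
    (hF : ∀ t ∈ Set.Icc (0 : ℝ) 1, ContinuousOn (F t) (spectrum ℂ w))
    (h1 : ∀ t ∈ Set.Icc (0 : ℝ) 1, ∀ z ∈ spectrum ℂ w, ‖F t z‖ = 1)
    (h2 : ∀ s ∈ Set.Icc (0 : ℝ) 1, ∀ t ∈ Set.Icc (0 : ℝ) 1, ∀ z ∈ spectrum ℂ w,
      ‖F s z - F t z‖ ≤ K * |s - t|) :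
    IsUnitaryPath K (fun t => cfc (F t) w) where
  mem_unitary t ht := by
    have hn : IsStarNormal w := isStarNormal_of_mem_unitary hw
    refine (cfc_unitary_iff (F t) w hn (hF t ht)).2 fun z hz => ?_
    have := Complex.normSq_eq_conj_mul_self (z := F t z)
    rw [Complex.star_def, ← this, Complex.normSq_eq_norm_sq, h1 t ht z hz]; simp
  norm_sub_le s hs t ht := by
    have hn : IsStarNormal w := isStarNormal_of_mem_unitary hw
    rw [← cfc_sub (F s) (F t) w (hF s hs) (hF t ht)]
    exact norm_cfc_le (by positivity) fun z hz => h2 s hs t ht z hz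

/-- A unitary with finite spectrum is joined to `1` by a `π`-Lipschitz path of unitaries commuting
with everything that commutes with the given unitary and its adjoint. -/
lemma exists_path_of_finite_spectrum {w : A} (hw : w ∈ unitary A) (hfin : (spectrum ℂ w).Finite) :
    ∃ p : ℝ → A, IsUnitaryPath Real.pi p ∧ p 0 = 1 ∧ p 1 = w ∧
      ∀ c, Commute w c → Commute (star w) c → ∀ t, Commute (p t) c := by
  have hn : IsStarNormal w := isStarNormal_of_mem_unitary hw
  refine ⟨fun t => cfc (fun z => Complex.exp (Complex.I * ((t * z.arg : ℝ) : ℂ))) w,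
    isUnitaryPath_cfc Real.pi_pos.le hw _ (fun t _ => hfin.continuousOn _) ?_ ?_, ?_, ?_,
    fun c h1 h2 t => h1.cfc h2 _⟩
  · intro t _ z _
    rw [mul_comm, Complex.norm_exp_ofReal_mul_I]
  · intro s _ t _ z _
    have : Complex.exp (Complex.I * ((s * z.arg : ℝ) : ℂ)) -
        Complex.exp (Complex.I * ((t * z.arg : ℝ) : ℂ)) =
        Complex.exp (((t * z.arg : ℝ) : ℂ) * Complex.I) *
          (Complex.exp (Complex.I * (((s - t) * z.arg : ℝ) : ℂ)) - 1) := by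
      rw [mul_sub, ← Complex.exp_add, mul_one]
      push_cast
      ring_nf
    rw [this, norm_mul, Complex.norm_exp_ofReal_mul_I, one_mul]
    refine Real.norm_exp_I_mul_ofReal_sub_one_le.trans ?_
    rw [norm_mul, Real.norm_eq_abs, Real.norm_eq_abs, mul_comm]
    gcongr
    exact Complex.abs_arg_le_pi z
  · simp
    exact cfc_const_one ℂ w
  · conv_rhs => rw [← cfc_id ℂ w]
    refine cfc_congr fun z hz => ?_
    have hz1 : ‖z‖ = 1 := by simpa using spectrum.subset_circle_of_unitary hw hz
    have := Complex.norm_mul_exp_arg_mul_I z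
    rw [hz1] at this
    simpa [mul_comm] using this

lemma norm_sub_one_le_of_mem_spectrum {w : A} (hw : IsStarNormal w) {z : ℂ}
    (hz : z ∈ spectrum ℂ w) : ‖z - 1‖ ≤ ‖w - 1‖ := by
  have h : w - 1 = cfc (fun z : ℂ => z - 1) w := by
    rw [cfc_sub (fun z : ℂ => z) _ w, cfc_const_one ℂ w, cfc_id' ℂ w]
  rw [h]
  exact norm_apply_le_norm_cfc (fun z : ℂ => z - 1) w hz

/-- A unitary `w` near `1` is joined to `1` by a short path of unitaries whose commutators with
a fixed element are controlled by the commutator of that element with `w`. -/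
lemma exists_path_of_norm_sub_one_le {w : A} (hw : w ∈ unitary A) {δ : ℝ} (hδ : ‖w - 1‖ ≤ δ)
    (hδ1 : δ ≤ 1) :
    ∃ p : ℝ → A, IsUnitaryPath (4 * δ) p ∧ p 0 = 1 ∧ p 1 = w ∧
      ∀ h, ∀ t ∈ Set.Icc (0 : ℝ) 1, ‖h * p t - p t * h‖ ≤ 2 * ‖h * w - w * h‖ := by
  have hn : IsStarNormal w := isStarNormal_of_mem_unitary hw
  have hδ0 : 0 ≤ δ := (norm_nonneg _).trans hδ
  let N : ℝ → ℂ → ℂ := fun t z => (1 + t) * z + (1 - t)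
  let D : ℝ → ℂ → ℂ := fun t z => (1 - t) * z + (1 + t)
  have hspec : ∀ z ∈ spectrum ℂ w, ‖z‖ = 1 ∧ ‖z - 1‖ ≤ δ := fun z hz =>
    ⟨by simpa using spectrum.subset_circle_of_unitary hw hz,
      (norm_sub_one_le_of_mem_spectrum hn hz).trans hδ⟩
  have hD1 : ∀ t ∈ Set.Icc (0 : ℝ) 1, ∀ z ∈ spectrum ℂ w, 1 ≤ ‖D t z‖ := by
    intro t ht z hz
    have e : D t z = 2 - -((1 - t : ℝ) * (z - 1)) := by simp only [D]; push_cast; ring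
    have e2 : ‖-(((1 - t : ℝ) : ℂ) * (z - 1))‖ ≤ 1 := by
      rw [norm_neg, norm_mul, Complex.norm_real, Real.norm_of_nonneg (by linarith [ht.2])]
      nlinarith [hspec z hz, ht.1, ht.2, norm_nonneg (z - 1)]
    rw [e]
    have := norm_sub_norm_le (2 : ℂ) (-(((1 - t : ℝ) : ℂ) * (z - 1)))
    have e3 : ‖(2 : ℂ)‖ = 2 := by simp
    linarith
  have hD0 : ∀ t ∈ Set.Icc (0 : ℝ) 1, ∀ z ∈ spectrum ℂ w, D t z ≠ 0 := by
    intro t ht z hz h0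
    have := hD1 t ht z hz
    rw [h0] at this
    norm_num at this
  have hND : ∀ t ∈ Set.Icc (0 : ℝ) 1, ∀ z ∈ spectrum ℂ w, ‖N t z‖ = ‖D t z‖ := by
    intro t ht z hz
    have hz1 : z * (starRingEnd ℂ) z = 1 := by
      rw [Complex.mul_conj, Complex.normSq_eq_norm_sq, (hspec z hz).1]; simp
    have : N t z = z * (starRingEnd ℂ) (D t z) := by
      simp only [N, D, map_add, map_mul, map_sub, map_one, Complex.conj_ofReal]
      linear_combination (-(1 - t : ℂ)) * hz1
    rw [this, norm_mul, (hspec z hz).1, one_mul, RCLike.norm_conj]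
  let F : ℝ → ℂ → ℂ := fun t z => N t z / D t z
  have hNc : ∀ t, Continuous (N t) := fun t => by fun_prop
  have hDc : ∀ t, Continuous (D t) := fun t => by fun_prop
  have hFc : ∀ t ∈ Set.Icc (0 : ℝ) 1, ContinuousOn (F t) (spectrum ℂ w) := fun t ht =>
    (hNc t).continuousOn.div (hDc t).continuousOn (hD0 t ht)
  have hp : IsUnitaryPath (4 * δ) (fun t => cfc (F t) w) := by
    refine isUnitaryPath_cfc (by positivity) hw F hFc ?_ ?_
    · intro t ht z hz
      simp only [F]
      rw [norm_div, hND t ht z hz, div_self (norm_ne_zero_iff.2 (hD0 t ht z hz))]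
    · intro s hs t ht z hz
      have e : F s z - F t z = ((s - t : ℝ) * (2 * (z + 1) * (z - 1))) / (D s z * D t z) := by
        simp only [F]
        rw [div_sub_div _ _ (hD0 s hs z hz) (hD0 t ht z hz)]
        congr 1
        simp only [N, D]
        push_cast
        ring
      have hz2 : ‖z + 1‖ ≤ 2 := by
        refine (norm_add_le _ _).trans ?_
        rw [(hspec z hz).1]; norm_num
      rw [e, norm_div, div_le_iff₀ (by
        have := hD1 s hs z hz; have := hD1 t ht z hz; rw [norm_mul]; positivity)]
      rw [norm_mul, norm_mul, norm_mul, norm_mul, Complex.norm_real, Real.norm_eq_abs]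
      have h1 : 1 ≤ ‖D s z‖ * ‖D t z‖ := one_le_mul_of_one_le_of_one_le (hD1 s hs z hz) (hD1 t ht z hz)
      have h2 : ‖(2 : ℂ)‖ * ‖z + 1‖ * ‖z - 1‖ ≤ 4 * δ := by
        have e3 : ‖(2 : ℂ)‖ = 2 := by simp
        rw [e3]
        nlinarith [(hspec z hz).2, norm_nonneg (z - 1), norm_nonneg (z + 1)]
      calc |s - t| * (‖(2 : ℂ)‖ * ‖z + 1‖ * ‖z - 1‖) ≤ |s - t| * (4 * δ) := by gcongr
        _ = 4 * δ * |s - t| * 1 := by ring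
        _ ≤ _ := by gcongr
  refine ⟨fun t => cfc (F t) w, hp, ?_, ?_, ?_⟩
  · rw [← cfc_const_one ℂ w]
    refine cfc_congr fun z hz => ?_
    have := hD0 0 (by simp) z hz
    simp only [F]
    rw [div_eq_one_iff_eq this]
    simp [N, D]
  · conv_rhs => rw [← cfc_id ℂ w]
    refine cfc_congr fun z hz => ?_
    simp only [F, N, D, id]
    push_cast
    ring
  · intro h t ht
    set x := cfc (F t) w
    set d := (((1 - t : ℝ) : ℂ) • w + ((1 + t : ℝ) : ℂ) • (1 : A)) with hd
    have hd' : d = cfc (D t) w := by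
      simp only [D]
      rw [cfc_add w (fun z : ℂ => (1 - t : ℂ) * z) _, cfc_const_mul _ (fun z : ℂ => z) w,
        cfc_id' ℂ w, cfc_const _ w hn, Algebra.algebraMap_eq_smul_one, hd]
      push_cast
      rfl
    have hxd : x * d = ((1 + t : ℝ) : ℂ) • w + ((1 - t : ℝ) : ℂ) • (1 : A) := by
      have : x * d = cfc (N t) w := by
        rw [hd', ← cfc_mul (F t) (D t) w (hFc t ht)]
        refine cfc_congr fun z hz => ?_
        simp only [F]
        exact div_mul_cancel₀ _ (hD0 t ht z hz)
      rw [this]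
      simp only [N]
      rw [cfc_add w (fun z : ℂ => (1 + t : ℂ) * z) _, cfc_const_mul _ (fun z : ℂ => z) w,
        cfc_id' ℂ w, cfc_const _ w hn, Algebra.algebraMap_eq_smul_one]
      push_cast
      rfl
    set c := h * w - w * h with hc
    have e1 : (h * x - x * h) * d = ((1 + t : ℝ) : ℂ) • c - x * (((1 - t : ℝ) : ℂ) • c) := by
      have e2 : h * d - d * h = ((1 - t : ℝ) : ℂ) • c := by
        simp only [hd, hc, mul_add, add_mul, mul_smul_comm, smul_mul_assoc, smul_sub]
        simp
      have e3 : h * (x * d) - (x * d) * h = ((1 + t : ℝ) : ℂ) • c := by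
        rw [hxd]
        simp only [hc, mul_add, add_mul, mul_smul_comm, smul_mul_assoc, smul_sub]
        simp
      rw [← e2, ← e3]
      noncomm_ring
    have hx1 : ‖x‖ ≤ 1 := norm_le_one_of_mem_unitary (hp.1 t ht)
    have hc0 := norm_nonneg c
    have b1 : ‖(h * x - x * h) * d‖ ≤ 2 * ‖c‖ := by
      rw [e1]
      refine (norm_sub_le _ _).trans ?_
      have : ‖x * (((1 - t : ℝ) : ℂ) • c)‖ ≤ (1 - t) * ‖c‖ := by
        refine (norm_mul_le _ _).trans ((mul_le_of_le_one_left (norm_nonneg _) hx1).trans ?_)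
        rw [norm_smul, Complex.norm_real, Real.norm_of_nonneg (by linarith [ht.2])]
      rw [norm_smul, Complex.norm_real, Real.norm_of_nonneg (by linarith [ht.1])]
      linarith
    set y := h * x - x * h
    have e4 : (2 : ℂ) • y = y * d - y * (((1 - t : ℝ) : ℂ) • (w - 1)) := by
      rw [← mul_sub, hd]
      have : ((1 - t : ℝ) : ℂ) • w + ((1 + t : ℝ) : ℂ) • (1 : A) -
          ((1 - t : ℝ) : ℂ) • (w - 1) = (2 : ℂ) • 1 := by
        push_cast
        module
      rw [this, mul_smul_comm, mul_one]
    have b2 : ‖(2 : ℂ) • y‖ = 2 * ‖y‖ := by rw [norm_smul]; simp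
    have b3 : ‖y * (((1 - t : ℝ) : ℂ) • (w - 1))‖ ≤ ‖y‖ := by
      refine (norm_mul_le _ _).trans (mul_le_of_le_one_right (norm_nonneg _) ?_)
      rw [norm_smul, Complex.norm_real, Real.norm_of_nonneg (by linarith [ht.2])]
      nlinarith [norm_nonneg (w - 1), ht.1, ht.2]
    have b4 := norm_sub_le (y * d) (y * (((1 - t : ℝ) : ℂ) • (w - 1)))
    rw [← e4, b2] at b4
    linarith

end Unitary

section Orthogonal

variable {A : Type*} [CStarAlgebra A]

lemma isStarProjection_sum {ι : Type*} (s : Finset ι) (F : ι → A)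
    (hF : ∀ k ∈ s, IsStarProjection (F k)) (hFF : ∀ k ∈ s, ∀ l ∈ s, k ≠ l → F k * F l = 0) :
    IsStarProjection (∑ k ∈ s, F k) := by
  refine ⟨?_, ?_⟩
  · rw [IsIdempotentElem, Finset.sum_mul_sum]
    refine Finset.sum_congr rfl fun k hk => ?_
    rw [Finset.sum_eq_single_of_mem k hk fun l hl hlk => hFF k hk l hl hlk.symm]
    exact (hF k hk).isIdempotentElem
  · rw [IsSelfAdjoint, star_sum]
    exact Finset.sum_congr rfl fun k hk => (hF k hk).isSelfAdjoint

/-- The norm of a sum of elements with orthogonal ranges and orthogonal supports is at most the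
largest of their norms. -/
lemma norm_sum_le_of_orthogonal {ι : Type*} (s : Finset ι) (F D : ι → A) {c : ℝ} (hc : 0 ≤ c)
    (hF : ∀ k ∈ s, IsStarProjection (F k)) (hFF : ∀ k ∈ s, ∀ l ∈ s, k ≠ l → F k * F l = 0)
    (hDF : ∀ k ∈ s, D k * F k = D k) (hDD : ∀ k ∈ s, ∀ l ∈ s, k ≠ l → star (D k) * D l = 0)
    (hD : ∀ k ∈ s, ‖D k‖ ≤ c) : ‖∑ k ∈ s, D k‖ ≤ c := by
  let _ := CStarAlgebra.spectralOrder A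
  have _ := CStarAlgebra.spectralOrderedRing A
  have h1 : star (∑ k ∈ s, D k) * ∑ k ∈ s, D k = ∑ k ∈ s, star (D k) * D k := by
    rw [star_sum, Finset.sum_mul_sum]
    exact Finset.sum_congr rfl fun k hk =>
      Finset.sum_eq_single_of_mem k hk fun l hl hlk => hDD k hk l hl hlk.symm
  have h2 : ∑ k ∈ s, star (D k) * D k ≤ ∑ k ∈ s, (c * c) • F k := by
    refine Finset.sum_le_sum fun k hk => ?_
    have e : star (D k) * D k = star (F k) * (star (D k) * D k) * F k := by
      conv_lhs => rw [← hDF k hk, star_mul]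
      noncomm_ring
    rw [e]
    refine (CStarAlgebra.star_left_conjugate_le_norm_smul (.star_mul_self _)).trans ?_
    rw [(hF k hk).isSelfAdjoint.star_eq, (hF k hk).isIdempotentElem.eq, CStarRing.norm_star_mul_self]
    refine smul_le_smul_of_nonneg_right ?_ ?_
    · have := hD k hk
      gcongr
    · have := star_mul_self_nonneg (F k)
      rwa [(hF k hk).isSelfAdjoint.star_eq, (hF k hk).isIdempotentElem.eq] at this
  have h3 := CStarAlgebra.norm_le_norm_of_nonneg_of_le
    (Finset.sum_nonneg fun k _ => star_mul_self_nonneg (D k)) h2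
  rw [← h1, CStarRing.norm_star_mul_self, ← Finset.smul_sum, norm_smul,
    Real.norm_of_nonneg (by positivity)] at h3
  have h4 := norm_le_one_of_isStarProjection (isStarProjection_sum s F hF hFF)
  nlinarith [norm_nonneg (∑ k ∈ s, D k)]

lemma norm_sum_le_of_orthogonal_of_parity (s : Finset ℤ) (F D : ℤ → A) {c : ℝ} (hc : 0 ≤ c)
    (hF : ∀ k, IsStarProjection (F k)) (hFF : ∀ k l, k ≠ l → F k * F l = 0)
    (hDF : ∀ k, D k * F k = D k)
    (hDD : ∀ k l, k ≠ l → (Even k ↔ Even l) → star (D k) * D l = 0)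
    (hD : ∀ k, ‖D k‖ ≤ c) : ‖∑ k ∈ s, D k‖ ≤ 2 * c := by
  rw [← Finset.sum_filter_add_sum_filter_not s (fun k => Even k), two_mul]
  refine (norm_add_le _ _).trans (add_le_add ?_ ?_)
  · refine norm_sum_le_of_orthogonal _ F D hc (fun k _ => hF k) (fun k _ l _ => hFF k l)
      (fun k _ => hDF k) (fun k hk l hl hkl => hDD k l hkl ?_) (fun k _ => hD k)
    simp only [Finset.mem_filter] at hk hl
    tauto
  · refine norm_sum_le_of_orthogonal _ F D hc (fun k _ => hF k) (fun k _ l _ => hFF k l)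
      (fun k _ => hDF k) (fun k hk l hl hkl => hDD k l hkl ?_) (fun k _ => hD k)
    simp only [Finset.mem_filter] at hk hl
    tauto

end Orthogonal

section FiniteDimensional

variable {A : Type*} [CStarAlgebra A] [FiniteDimensional ℂ A]

lemma finite_spectrum_complex (a : A) : (spectrum ℂ a).Finite := by
  obtain ⟨p, hp, hpa⟩ := (Algebra.IsIntegral.of_finite ℂ A).isIntegral a
  refine (p.roots.toFinset.finite_toSet).subset fun z hz => ?_
  have h1 := spectrum.subset_polynomial_aeval a p ⟨z, hz, rfl⟩
  rw [Polynomial.aeval_def, hpa, spectrum.mem_iff, sub_zero] at h1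
  simp only [Finset.mem_coe, Multiset.mem_toFinset, Polynomial.mem_roots hp.ne_zero,
    Polynomial.IsRoot]
  by_contra h
  exact h1 ((IsUnit.mk0 _ h).map (algebraMap ℂ A))

lemma finite_spectrum_real (a : A) : (spectrum ℝ a).Finite := by
  rw [← spectrum.preimage_algebraMap ℂ]
  exact (finite_spectrum_complex a).preimage (FaithfulSMul.algebraMap_injective ℝ ℂ).injOn

/-- A Schur complement argument: an invertible intertwiner of two elements that agree off a corner
can be replaced by an invertible intertwiner commuting with that corner. -/
lemma exists_isUnit_intertwining_commute {E P R T : A} (hE : IsIdempotentElem E)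
    (hPE : Commute P E) (hRE : Commute R E) (hPR : (1 - E) * P = (1 - E) * R)
    (hT : IsUnit T) (hTP : T * P = R * T) :
    ∃ Z : A, IsUnit Z ∧ Z * P = R * Z ∧ Commute Z E := by
  obtain ⟨r, hr1, hr2⟩ : ∃ r : ℂ, IsUnit (T + r • (1 - E)) ∧
      IsUnit ((1 - E) * T * (1 - E) + r • (1 : A)) := by
    have h1 : ∀ᶠ r : ℂ in nhds 0, IsUnit (T + r • (1 - E)) := by
      have hc : Continuous fun r : ℂ => T + r • (1 - E) := by fun_prop
      refine hc.continuousAt.eventually (Units.isOpen.mem_nhds ?_)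
      simpa using hT
    have h2 : ∀ᶠ r : ℂ in nhdsWithin 0 {0}ᶜ, IsUnit ((1 - E) * T * (1 - E) + r • (1 : A)) := by
      have hf : (Neg.neg ⁻¹' spectrum ℂ ((1 - E) * T * (1 - E))).Finite :=
        (finite_spectrum_complex _).preimage neg_injective.injOn
      filter_upwards [nhdsNE_le_cofinite 0 hf.compl_mem_cofinite] with r hr
      rw [Set.mem_compl_iff, Set.mem_preimage, spectrum.notMem_iff] at hr
      have := hr.neg
      rwa [neg_sub, map_neg, sub_neg_eq_add, Algebra.algebraMap_eq_smul_one] at this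
    exact ((h1.filter_mono nhdsWithin_le_nhds).and h2).exists
  set c := 1 - E with hc
  set T' := T + r • c with hT'
  set M := c * T * c + r • (1 : A) with hM
  have hcc : c * c = c := hE.one_sub
  have hcE : c * E = 0 := by rw [hc, sub_mul, hE.eq]; simp
  have hEc : E * c = 0 := by rw [hc, mul_sub, hE.eq]; simp
  have hE1 : E = 1 - c := by rw [hc]; abel
  have hPc : P * c = c * P := ((Commute.one_right P).sub_right hPE).eq
  have hRc : R * c = c * R := ((Commute.one_right R).sub_right hRE).eq
  have hT'P : T' * P = R * T' := by
    rw [hT', add_mul, mul_add, hTP, smul_mul_assoc, mul_smul_comm, hPR, hRc]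
  have hMc : M * c = c * M := by
    simp only [hM, add_mul, mul_add, smul_mul_assoc, mul_smul_comm, mul_one, one_mul]
    rw [mul_assoc _ c c, hcc, ← mul_assoc, ← mul_assoc, hcc]
  have hMT : c * T' * c = M * c := by
    simp only [hT', hM, add_mul, mul_add, smul_mul_assoc, mul_smul_comm, one_mul, mul_assoc, hcc]
  have hMP : M * (c * P) = (c * P) * M := by
    have h1 : c * T * c * (c * P) = (c * P) * (c * T * c) := by
      calc c * T * c * (c * P) = c * T * (c * c) * P := by noncomm_ring
        _ = c * T * (P * c) := by rw [hcc, hPc]; noncomm_ring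
        _ = c * (T * P) * c := by noncomm_ring
        _ = (c * c) * R * T * c := by rw [hTP, hcc]; noncomm_ring
        _ = c * (R * c) * T * c := by rw [hRc]; noncomm_ring
        _ = (c * R) * (c * T * c) := by noncomm_ring
        _ = (c * P) * (c * T * c) := by rw [← hPR]
    simp only [hM, add_mul, mul_add, h1, smul_mul_assoc, mul_smul_comm, one_mul, mul_one]
  obtain ⟨Mu, hMu⟩ := hr2
  obtain ⟨Tu, hTu⟩ := hr1
  set a : A := ((Mu⁻¹ : Aˣ) : A) with ha
  set S : A := ((Tu⁻¹ : Aˣ) : A) with hS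
  have haM : a * M = 1 := by rw [← hMu]; exact Mu.inv_mul
  have hTS : T' * S = 1 := by rw [← hTu]; exact Tu.mul_inv
  have hac : a * c = c * a := by
    have : Commute (Mu : A) c := by rw [hMu]; exact hMc
    exact this.units_inv_left
  have haP : a * (c * P) = (c * P) * a := by
    have : Commute (Mu : A) (c * P) := by rw [hMu]; exact hMP
    exact this.units_inv_left
  set z := E * T' * E - E * T' * a * c * T' * E with hz
  have hEz : E * z = z := by
    simp only [hz, mul_sub, ← mul_assoc, hE.eq]
  have hzE : z * E = z := by
    simp only [hz, sub_mul, mul_assoc, hE.eq]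
  have hzc : z * c = 0 := by rw [← hzE, mul_assoc, hEc, mul_zero]
  have hcz : c * z = 0 := by rw [← hEz, ← mul_assoc, hcE, zero_mul]
  have hinv : z * (E * S * E) = E := by
    have h1 : c * T' * E * S * E = -(M * c * S * E) := by
      rw [← hMT]
      have : c * T' * E * S * E + c * T' * c * S * E = 0 := by
        calc _ = c * (T' * S) * E := by rw [hE1]; noncomm_ring
          _ = 0 := by rw [hTS, mul_one, hcE]
      exact eq_neg_of_add_eq_zero_left this
    calc z * (E * S * E) = z * E * S * E := by noncomm_ring
      _ = z * S * E := by rw [hzE]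
      _ = E * T' * E * S * E - E * T' * a * (c * T' * E * S * E) := by rw [hz]; noncomm_ring
      _ = E * T' * E * S * E + E * T' * (a * M) * c * S * E := by rw [h1]; noncomm_ring
      _ = E * (T' * S) * E := by rw [haM, hE1]; noncomm_ring
      _ = E := by rw [hTS, mul_one, hE.eq]
  have _ := IsNoetherianRing.of_finite ℂ A
  have hZ : (z + c) * (E * S * E + c) = 1 := by
    have h2 : c * (E * S * E) = 0 := by rw [← mul_assoc, ← mul_assoc, hcE]; simp
    rw [add_mul, mul_add, mul_add, hinv, hzc, h2, hcc, hc]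
    abel
  have hzP : z * P = R * z := by
    have h1 : E * T' * E * P = R * (E * T' * E) := by
      calc E * T' * E * P = E * (T' * P) * E := by rw [mul_assoc, ← hPE.eq]; noncomm_ring
        _ = (E * R) * T' * E := by rw [hT'P]; noncomm_ring
        _ = _ := by rw [← hRE.eq]; noncomm_ring
    have h2 : E * T' * a * c * T' * E * P = R * (E * T' * a * c * T' * E) := by
      calc E * T' * a * c * T' * E * P = E * T' * a * c * (T' * P) * E := by
            rw [mul_assoc _ E P, ← hPE.eq]; noncomm_ring
        _ = E * T' * a * (c * R) * T' * E := by rw [hT'P]; noncomm_ring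
        _ = E * T' * (a * (c * P)) * T' * E := by rw [← hPR]; noncomm_ring
        _ = E * T' * (P * c) * a * T' * E := by rw [haP, hPc]; noncomm_ring
        _ = E * (T' * P) * (c * a) * T' * E := by noncomm_ring
        _ = (E * R) * T' * (a * c) * T' * E := by rw [hT'P, hac]; noncomm_ring
        _ = _ := by rw [← hRE.eq]; noncomm_ring
    rw [hz, sub_mul, mul_sub R, h1, h2]
  refine ⟨z + c, ⟨⟨z + c, _, hZ, mul_eq_one_comm.1 hZ⟩, rfl⟩, ?_, ?_⟩
  · rw [add_mul, mul_add, hzP, hPR, hRc]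
  · rw [Commute, SemiconjBy, add_mul, mul_add, hzE, hEz, hcE, hEc]

end FiniteDimensional

section Cut

variable {A : Type*} [CStarAlgebra A] [FiniteDimensional ℂ A]

/-- Rounding a self-adjoint element with small `y * y - y` to a projection. -/
lemma exists_isStarProjection_near {y : A} (hy : IsSelfAdjoint y) :
    ∃ q : A, IsStarProjection q ∧ (∃ x, q = x * y) ∧ ‖q - y‖ ≤ 2 * ‖y * y - y‖ := by
  have hc : ∀ f : ℝ → ℝ, ContinuousOn f (spectrum ℝ y) := (finite_spectrum_real y).continuousOn
  set q := cfc (fun s : ℝ => if 1 / 2 < s then (1 : ℝ) else 0) y with hq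
  refine ⟨q, ⟨?_, cfc_predicate _ y⟩, ⟨cfc (fun s : ℝ => if 1 / 2 < s then s⁻¹ else 0) y, ?_⟩, ?_⟩
  · rw [IsIdempotentElem, hq, ← cfc_mul _ _ y (hc _) (hc _)]
    exact cfc_congr fun s _ => by split_ifs <;> simp
  · refine Eq.trans ?_ (congrArg _ (cfc_id ℝ y))
    rw [hq, ← cfc_mul _ _ y (hc _) (hc _)]
    refine cfc_congr fun s _ => ?_
    dsimp only [id]
    split_ifs with h
    · rw [inv_mul_cancel₀]; linarith
    · simp
  · have h1 : q - y = cfc (fun s : ℝ => (if 1 / 2 < s then (1 : ℝ) else 0) - s) y := by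
      rw [cfc_sub _ (fun s : ℝ => s) y (hc _) (hc _), cfc_id' ℝ y]
    have h2 : y * y - y = cfc (fun s : ℝ => s * s - s) y := by
      rw [cfc_sub _ (fun s : ℝ => s) y (hc _) (hc _), cfc_mul _ _ y (hc _) (hc _), cfc_id' ℝ y]
    rw [h1]
    refine norm_cfc_le (by positivity) fun s hs => ?_
    rw [h2]
    refine le_trans ?_ (mul_le_mul_of_nonneg_left
      (norm_apply_le_norm_cfc (fun s : ℝ => s * s - s) y hs (hc _)) zero_le_two)
    rw [show s * s - s = s * (s - 1) by ring, norm_mul, Real.norm_eq_abs, Real.norm_eq_abs,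
      Real.norm_eq_abs]
    split_ifs with h
    · rw [abs_sub_comm 1 s, abs_of_pos (by linarith : 0 < s)]
      nlinarith [abs_nonneg (s - 1)]
    · rw [zero_sub, abs_neg, abs_of_nonpos (by linarith : s - 1 ≤ 0)]
      nlinarith [abs_nonneg s]

/-- If a unitary moves a projection `P` essentially only within `f - e`, where `e ≤ P ≤ f`, then
its effect on `P` can be undone by a unitary commuting with `f - e`. -/
lemma exists_unitary_undoing_cut {u e P f : A} (hu : u ∈ unitary A) (he : IsStarProjection e)
    (hP : IsStarProjection P) (hf : IsStarProjection f) (heP : e * P = e) (hPe : P * e = e)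
    (hPf : P * f = P) (hfP : f * P = P) {η : ℝ} (h1 : ‖e * (u * (1 - P))‖ ≤ η)
    (h2 : ‖(1 - f) * (u * P)‖ ≤ η) (hη : η ≤ 1 / 100) :
    ∃ W R : A, W ∈ unitary A ∧ W * R = P * W ∧ Commute W (f - e) ∧ R = e + (f - e) * R ∧
      ‖R - u * P * star u‖ ≤ 8 * η := by
  have hη0 : 0 ≤ η := (norm_nonneg _).trans h1
  have huu : star u * u = 1 := (Unitary.mem_iff.1 hu).1
  have huu' : u * star u = 1 := (Unitary.mem_iff.1 hu).2
  have hee := he.isIdempotentElem.eq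
  have hff := hf.isIdempotentElem.eq
  have hPP := hP.isIdempotentElem.eq
  have hef : e * f = e := by rw [← heP, mul_assoc, hPf]
  have hfe : f * e = e := by rw [← hPe, ← mul_assoc, hfP]
  set p' := u * P * star u with hp'
  have hp's : star p' = p' := by
    simp only [hp', star_mul, star_star, hP.isSelfAdjoint.star_eq, mul_assoc]
  have hp'p' : p' * p' = p' := by
    calc p' * p' = u * P * (star u * u) * P * star u := by rw [hp']; noncomm_ring
      _ = u * (P * P) * star u := by rw [huu]; noncomm_ring
      _ = p' := by rw [hPP]
  have hb1 : ‖e * (1 - p')‖ ≤ η := by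
    have : e * (1 - p') = e * (u * (1 - P)) * star u := by
      have : e * (u * (1 - P)) * star u = e * (u * star u - p') := by rw [hp']; noncomm_ring
      rw [this, huu']
    rwa [this, CStarRing.norm_mul_mem_unitary _ (Unitary.star_mem hu)]
  have hb2 : ‖(1 - f) * p'‖ ≤ η := by
    have : (1 - f) * p' = (1 - f) * (u * P) * star u := by rw [hp']; noncomm_ring
    rwa [this, CStarRing.norm_mul_mem_unitary _ (Unitary.star_mem hu)]
  have hb1' : ‖(1 - p') * e‖ ≤ η := by
    rw [← norm_star]
    simpa [hp's, he.isSelfAdjoint.star_eq] using hb1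
  have hb2' : ‖p' * (1 - f)‖ ≤ η := by
    rw [← norm_star]
    simpa [hp's, hf.isSelfAdjoint.star_eq] using hb2
  set E := f - e with hE
  have hEE : E * E = E := by
    rw [hE, mul_sub, sub_mul, sub_mul, hff, hee, hef, hfe]; abel
  have hEs : star E = E := by
    rw [hE, star_sub, hf.isSelfAdjoint.star_eq, he.isSelfAdjoint.star_eq]
  have hE1 : ‖E‖ ≤ 1 := norm_le_one_of_isStarProjection ⟨hEE, hEs⟩
  have hp'1 : ‖p'‖ ≤ 1 := norm_le_one_of_isStarProjection ⟨hp'p', hp's⟩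
  have hEe : E * e = 0 := by rw [hE, sub_mul, hfe, hee, sub_self]
  have heE : e * E = 0 := by rw [hE, mul_sub, hef, hee, sub_self]
  have hm : ∀ {x y : A} {c : ℝ}, ‖x‖ ≤ 1 → ‖y‖ ≤ c → ‖x * y‖ ≤ c := fun hx hy =>
    (norm_mul_le _ _).trans ((mul_le_of_le_one_left (norm_nonneg _) hx).trans hy)
  have hm' : ∀ {x y : A} {c : ℝ}, ‖x‖ ≤ c → ‖y‖ ≤ 1 → ‖x * y‖ ≤ c := fun hx hy =>
    (norm_mul_le _ _).trans ((mul_le_of_le_one_right (norm_nonneg _) hy).trans hx)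
  have hEpe : E * p' * e = -(E * ((1 - p') * e)) := by
    have : E * ((1 - p') * e) = E * e - E * p' * e := by noncomm_ring
    rw [this, hEe, zero_sub, neg_neg]
  have hEpe' : ‖E * p' * e‖ ≤ η := by
    rw [hEpe, norm_neg]; exact hm hE1 hb1'
  have hEpg : ‖E * p' * (1 - f)‖ ≤ η := by
    rw [mul_assoc]; exact hm hE1 hb2'
  set y := E * p' * E with hy
  have hys : IsSelfAdjoint y := by
    rw [IsSelfAdjoint, hy, star_mul, star_mul, hEs, hp's]
    exact (mul_assoc E p' E).symm
  have hyy : ‖y * y - y‖ ≤ 2 * η := by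
    have : y * y - y = -(E * p' * e * (p' * E) + E * p' * (1 - f) * (p' * E)) := by
      have e1 : y * y = E * p' * (E * E) * p' * E := by rw [hy]; noncomm_ring
      have e2 : y = E * (p' * p') * E := by rw [hp'p']
      rw [e1, hEE]
      conv_lhs => rw [e2]
      rw [hE]; noncomm_ring
    rw [this, norm_neg, two_mul]
    exact (norm_add_le _ _).trans (add_le_add (hm' hEpe' (hm hp'1 hE1)) (hm' hEpg (hm hp'1 hE1)))
  obtain ⟨Q, hQ, ⟨x, hQx⟩, hQy⟩ := exists_isStarProjection_near hys
  have hQE : Q * E = Q := by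
    rw [hQx, hy]; simp only [mul_assoc, hEE]
  have hEQ : E * Q = Q := by
    have := congrArg star hQE
    rwa [star_mul, hEs, hQ.isSelfAdjoint.star_eq] at this
  set R := e + Q with hR
  have hER : E * R = Q := by rw [hR, mul_add, hEe, hEQ, zero_add]
  have hRE : R * E = Q := by rw [hR, add_mul, heE, hQE, zero_add]
  have hRR : R * R = R := by
    have h3 : e * Q = 0 := by rw [← hEQ, ← mul_assoc, heE, zero_mul]
    have h4 : Q * e = 0 := by rw [← hQE, mul_assoc, hEe, mul_zero]
    rw [hR, add_mul, mul_add, mul_add, hee, h3, h4, hQ.isIdempotentElem.eq]; abel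
  have hRs : star R = R := by
    rw [hR, star_add, he.isSelfAdjoint.star_eq, hQ.isSelfAdjoint.star_eq]
  have hRp : ‖R - p'‖ ≤ 8 * η := by
    have e1 : R - p' = (Q - y) + ((e * (1 - p') - (1 - f) * p') - (E * p' * e + E * p' * (1 - f))) := by
      rw [hR, hy, hE]; noncomm_ring
    rw [e1]
    have b1 := norm_add_le (Q - y)
      ((e * (1 - p') - (1 - f) * p') - (E * p' * e + E * p' * (1 - f)))
    have b2 := norm_sub_le (e * (1 - p') - (1 - f) * p') (E * p' * e + E * p' * (1 - f))
    have b3 := norm_sub_le (e * (1 - p')) ((1 - f) * p')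
    have b4 := norm_add_le (E * p' * e) (E * p' * (1 - f))
    linarith
  set T := R * u * P + (1 - R) * u * (1 - P) with hT
  have hTP : T * P = R * T := by
    have e1 : T * P = R * u * P := by
      have e2 : T * P = R * u * (P * P) + (1 - R) * u * (P - P * P) := by rw [hT]; noncomm_ring
      rw [e2, hPP]; simp
    have e2 : R * T = R * u * P := by
      have e3 : R * T = (R * R) * u * P + (R - R * R) * u * (1 - P) := by rw [hT]; noncomm_ring
      rw [e3, hRR]; simp
    rw [e1, e2]
  have hTu : ‖T - u‖ < 1 := by
    have hpu : p' * u = u * P := by rw [hp', mul_assoc, huu, mul_one]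
    have e1 : T - u = -((R - p') * (u * (1 - P)) + (p' - R) * (u * P)) := by
      have e2 : (R - p') * (u * (1 - P)) = R * u * (1 - P) := by
        have : p' * (u * (1 - P)) = u * (P - P * P) := by
          rw [← mul_assoc, hpu]; noncomm_ring
        rw [sub_mul, this, hPP]; noncomm_ring
      have e3 : (p' - R) * (u * P) = (1 - R) * u * P := by
        have : p' * (u * P) = u * (P * P) := by
          rw [← mul_assoc, hpu]; noncomm_ring
        rw [sub_mul, this, hPP]; noncomm_ring
      rw [e2, e3, hT]; noncomm_ring
    have hu1 := norm_le_one_of_mem_unitary hu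
    have b1 : ‖(R - p') * (u * (1 - P))‖ ≤ 8 * η :=
      hm' hRp (hm hu1 (norm_le_one_of_isStarProjection hP.one_sub))
    have b2 : ‖(p' - R) * (u * P)‖ ≤ 8 * η :=
      hm' (by rwa [norm_sub_rev]) (hm hu1 (norm_le_one_of_isStarProjection hP))
    rw [e1, norm_neg]
    have := norm_add_le ((R - p') * (u * (1 - P))) ((p' - R) * (u * P))
    linarith
  have hPE : P * E = E * P := by
    rw [hE, mul_sub, sub_mul, hPf, hfP, hPe, heP]
  have hPR : (1 - E) * P = (1 - E) * R := by
    have e1 : E * P = P - e := by rw [hE, sub_mul, hfP, heP]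
    rw [sub_mul 1 E P, sub_mul 1 E R, hER, e1, hR]; simp
  obtain ⟨Z, hZ, hZP, hZE⟩ := exists_isUnit_intertwining_commute (E := E) (P := P) (R := R)
    hEE hPE (hRE.trans hER.symm) hPR (isUnit_of_norm_sub_lt_one hu hTu) hTP
  have hZP' : P * star Z = star Z * R := by
    have := congrArg star hZP
    rwa [star_mul, star_mul, hP.isSelfAdjoint.star_eq, hRs] at this
  have hZE' : star Z * E = E * star Z := by
    have := congrArg star hZE.eq
    rw [star_mul, star_mul, hEs] at this
    exact this.symm
  obtain ⟨s, hV, hs, -⟩ := exists_polar_of_isUnit hZ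
  have hsP : s * P = P * s := (hs P (by
    rw [Commute, SemiconjBy, mul_assoc, hZP, ← mul_assoc, ← hZP', mul_assoc])).eq
  have hsE : s * E = E * s := (hs E (by
    rw [Commute, SemiconjBy, mul_assoc, hZE.eq, ← mul_assoc, hZE', mul_assoc])).eq
  have hVP : Z * s * P = R * (Z * s) := by
    rw [mul_assoc, hsP, ← mul_assoc, hZP, mul_assoc]
  have hVE : Z * s * E = E * (Z * s) := by
    rw [mul_assoc, hsE, ← mul_assoc, hZE.eq, mul_assoc]
  refine ⟨star (Z * s), R, Unitary.star_mem hV, ?_, ?_, by rw [hER], hRp⟩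
  · have := congrArg star hVP
    rw [star_mul, star_mul _ (Z * s), hP.isSelfAdjoint.star_eq, hRs] at this
    exact this.symm
  · have := congrArg star hVE
    rw [star_mul, star_mul _ (Z * s), hEs] at this
    exact this.symm

end Cut

section Filter

open MeasureTheory FourierTransform SchwartzMap
open scoped ContDiff

/-- An integrable function with finite first moment, integral one, and Fourier transform supported
in `(-1, 1)`. -/
lemma exists_fourier_cutoff : ∃ f : ℝ → ℂ, Integrable f ∧ Integrable (fun t => |t| * ‖f t‖) ∧
    ∫ t, f t = 1 ∧ ∀ w : ℝ, 1 ≤ |w| →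
      ∫ t, Complex.exp (↑(-2 * Real.pi * t * w) * Complex.I) * f t = 0 := by
  let b : ContDiffBump (0 : ℝ) := ⟨1 / 2, 1, by norm_num, by norm_num⟩
  have hsupp : HasCompactSupport fun x : ℝ => (b x : ℂ) :=
    b.hasCompactSupport.comp_left (g := fun r : ℝ => (r : ℂ)) (by simp)
  have hsm : ContDiff ℝ ∞ fun x : ℝ => (b x : ℂ) :=
    Complex.ofRealCLM.contDiff.comp b.contDiff
  let φ : 𝓢(ℝ, ℂ) := hsupp.toSchwartzMap hsm
  have hF : ∀ w : ℝ, ∫ t, Complex.exp (↑(-2 * Real.pi * t * w) * Complex.I) * (𝓕⁻ φ) t = b w := by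
    intro w
    have h1 : 𝓕 (𝓕⁻ φ) = φ := FourierTransform.fourier_fourierInv_eq φ
    have h2 : (𝓕 (𝓕⁻ φ)) w = φ w := by rw [h1]
    rw [SchwartzMap.fourier_coe, Real.fourier_real_eq_integral_exp_smul] at h2
    exact h2
  refine ⟨(𝓕⁻ φ : 𝓢(ℝ, ℂ)), (𝓕⁻ φ).integrable, ?_, ?_, fun w hw => ?_⟩
  · exact ((𝓕⁻ φ).integrable_pow_mul volume 1).congr (.of_forall fun t => by
      simp only [pow_one, Real.norm_eq_abs])
  · have := hF 0
    rw [b.one_of_mem_closedBall (by simp [b])] at this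
    simpa using this
  · rw [hF w, b.zero_of_le_dist (by simpa [b] using hw)]; simp

variable {A : Type*} [CStarAlgebra A]

lemma sum_smul_mul_sum_smul {I : Finset ℝ} {e : ℝ → A} (he : ∀ r, IsStarProjection (e r))
    (hee : ∀ r s, r ≠ s → e r * e s = 0) (g k : ℝ → ℂ) :
    (∑ r ∈ I, g r • e r) * (∑ r ∈ I, k r • e r) = ∑ r ∈ I, (g r * k r) • e r := by
  rw [Finset.sum_mul_sum]
  refine Finset.sum_congr rfl fun r hr => ?_
  rw [Finset.sum_eq_single_of_mem r hr fun s _ hs => by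
    rw [smul_mul_smul_comm, hee r s hs.symm, smul_zero]]
  rw [smul_mul_smul_comm, (he r).isIdempotentElem.eq]

lemma mul_sum_smul_of_mem {I : Finset ℝ} {e : ℝ → A} (he : ∀ r, IsStarProjection (e r))
    (hee : ∀ r s, r ≠ s → e r * e s = 0) (g : ℝ → ℂ) {r : ℝ} (hr : r ∈ I) :
    e r * (∑ s ∈ I, g s • e s) = g r • e r := by
  rw [Finset.mul_sum, Finset.sum_eq_single_of_mem r hr fun s _ hs => by
    rw [mul_smul_comm, hee r s hs.symm, smul_zero]]
  rw [mul_smul_comm, (he r).isIdempotentElem.eq]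

lemma sum_smul_mul_of_mem {I : Finset ℝ} {e : ℝ → A} (he : ∀ r, IsStarProjection (e r))
    (hee : ∀ r s, r ≠ s → e r * e s = 0) (g : ℝ → ℂ) {r : ℝ} (hr : r ∈ I) :
    (∑ s ∈ I, g s • e s) * e r = g r • e r := by
  rw [Finset.sum_mul, Finset.sum_eq_single_of_mem r hr fun s _ hs => by
    rw [smul_mul_assoc, hee s r hs, smul_zero]]
  rw [smul_mul_assoc, (he r).isIdempotentElem.eq]

/-- The one-parameter unitary group generated by `-2π h`, for `h = ∑ r • e r`. -/
noncomputable def diagGroup (I : Finset ℝ) (e : ℝ → A) (t : ℝ) : A :=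
  ∑ r ∈ I, Complex.exp (↑(-2 * Real.pi * t * r) * Complex.I) • e r

lemma star_diagGroup {I : Finset ℝ} {e : ℝ → A} (he : ∀ r, IsStarProjection (e r)) (t : ℝ) :
    star (diagGroup I e t) = diagGroup I e (-t) := by
  rw [diagGroup, diagGroup, star_sum]
  refine Finset.sum_congr rfl fun r _ => ?_
  rw [star_smul, (he r).isSelfAdjoint.star_eq, Complex.star_def, ← Complex.exp_conj, map_mul,
    Complex.conj_ofReal, Complex.conj_I]
  congr 2
  push_cast
  ring

lemma diagGroup_mul_neg {I : Finset ℝ} {e : ℝ → A} (he : ∀ r, IsStarProjection (e r))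
    (hee : ∀ r s, r ≠ s → e r * e s = 0) (hsum : ∑ r ∈ I, e r = 1) (t : ℝ) :
    diagGroup I e t * diagGroup I e (-t) = 1 := by
  rw [diagGroup, diagGroup, sum_smul_mul_sum_smul he hee, ← hsum]
  refine Finset.sum_congr rfl fun r _ => ?_
  rw [← Complex.exp_add, ← add_mul, ← Complex.ofReal_add]
  have : -2 * Real.pi * t * r + -2 * Real.pi * -t * r = 0 := by ring
  rw [this]
  simp

lemma diagGroup_mem_unitary {I : Finset ℝ} {e : ℝ → A} (he : ∀ r, IsStarProjection (e r))
    (hee : ∀ r s, r ≠ s → e r * e s = 0) (hsum : ∑ r ∈ I, e r = 1) (t : ℝ) :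
    diagGroup I e t ∈ unitary A := by
  rw [Unitary.mem_iff, star_diagGroup he]
  have := diagGroup_mul_neg he hee hsum (-t)
  rw [neg_neg] at this
  exact ⟨this, diagGroup_mul_neg he hee hsum t⟩

lemma hasDerivAt_diagGroup {I : Finset ℝ} {e : ℝ → A} (he : ∀ r, IsStarProjection (e r))
    (hee : ∀ r s, r ≠ s → e r * e s = 0) (t : ℝ) :
    HasDerivAt (diagGroup I e) ((-2 * Real.pi * Complex.I : ℂ) •
      ((∑ r ∈ I, (r : ℂ) • e r) * diagGroup I e t)) t := by
  rw [diagGroup, sum_smul_mul_sum_smul he hee, Finset.smul_sum]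
  unfold diagGroup
  refine HasDerivAt.fun_sum fun r _ => ?_
  have h1 : HasDerivAt (fun t : ℝ => (↑(-2 * Real.pi * t * r) * Complex.I : ℂ))
      ((-2 * Real.pi * Complex.I : ℂ) * r) t := by
    have := ((hasDerivAt_id t).ofReal_comp.const_mul (-2 * Real.pi * r * Complex.I : ℂ))
    refine (this.congr_deriv ?_).congr_of_eventuallyEq (.of_forall fun s => ?_)
    · push_cast; ring
    · simp only [id]; push_cast; ring
  refine (h1.cexp.smul_const (e r)).congr_deriv ?_
  rw [smul_smul]
  congr 1
  ring

lemma norm_diagGroup_conj_sub_le {I : Finset ℝ} {e : ℝ → A} (he : ∀ r, IsStarProjection (e r))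
    (hee : ∀ r s, r ≠ s → e r * e s = 0) (hsum : ∑ r ∈ I, e r = 1) {h u : A}
    (hh : h = ∑ r ∈ I, (r : ℂ) • e r) (t : ℝ) :
    ‖diagGroup I e t * u * diagGroup I e (-t) - u‖ ≤ 2 * Real.pi * ‖h * u - u * h‖ * |t| := by
  set c : ℂ := -2 * Real.pi * Complex.I with hc
  have hcomm : ∀ t, diagGroup I e t * h = h * diagGroup I e t := fun t => by
    rw [hh, diagGroup, sum_smul_mul_sum_smul he hee, sum_smul_mul_sum_smul he hee]
    simp only [mul_comm]
  have hd : ∀ t, HasDerivAt (fun t => diagGroup I e t * u * diagGroup I e (-t))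
      (c • (diagGroup I e t * (h * u - u * h) * diagGroup I e (-t))) t := fun t => by
    have h1 := hasDerivAt_diagGroup he hee (I := I) t
    have h2 := (hasDerivAt_diagGroup he hee (I := I) (-t)).scomp t (hasDerivAt_neg t)
    rw [← hh, ← hc] at h1 h2
    refine ((h1.mul_const u).mul h2).congr_deriv ?_
    rw [← hcomm t, neg_smul, one_smul, mul_neg, mul_smul_comm, smul_mul_assoc, smul_mul_assoc,
      ← smul_neg, ← smul_add]
    congr 1
    simp only [Function.comp_apply]
    noncomm_ring
  have hU := diagGroup_mem_unitary he hee hsum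
  have key := convex_univ.norm_image_sub_le_of_norm_hasDerivWithin_le
    (f := fun t => diagGroup I e t * u * diagGroup I e (-t))
    (C := 2 * Real.pi * ‖h * u - u * h‖) (fun t _ => (hd t).hasDerivWithinAt)
    (fun t _ => ?_) (Set.mem_univ 0) (Set.mem_univ t)
  · have h0 : diagGroup I e 0 = 1 := by simp [diagGroup, hsum]
    simpa [h0] using key
  · rw [norm_smul, CStarRing.norm_mul_mem_unitary _ (hU _), CStarRing.norm_mem_unitary_mul _ (hU _)]
    refine le_of_eq ?_
    rw [hc]
    simp [abs_of_pos Real.pi_pos]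

end Filter

open MeasureTheory in
/-- An element `u` almost commuting with `h = ∑ r • e r` is close to an element which is
band-limited with respect to the spectral decomposition of `h`. -/
lemma exists_band_limited_near : ∃ C : ℝ, 0 ≤ C ∧ ∀ (A : Type*) [CStarAlgebra A] (I : Finset ℝ)
    (e : ℝ → A), (∀ r, IsStarProjection (e r)) → (∀ r s, r ≠ s → e r * e s = 0) →
    ∑ r ∈ I, e r = 1 → ∀ h u : A, h = ∑ r ∈ I, (r : ℂ) • e r →
    ∃ x, ‖x - u‖ ≤ C * ‖h * u - u * h‖ ∧ ∀ r ∈ I, ∀ s ∈ I, 1 ≤ |r - s| → e r * x * e s = 0 := by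
  obtain ⟨f, hf, hf1, hf0, hfw⟩ := exists_fourier_cutoff
  refine ⟨2 * Real.pi * ∫ t, |t| * ‖f t‖, by positivity, fun A _ I e he hee hsum h u hh => ?_⟩
  set G : ℝ → A := fun t => diagGroup I e t * u * diagGroup I e (-t) with hG
  have hUc : Continuous (diagGroup I e) :=
    continuous_iff_continuousAt.2 fun t => (hasDerivAt_diagGroup he hee t).continuousAt
  have hGc : Continuous G := (hUc.mul continuous_const).mul (hUc.comp continuous_neg)
  have hU := diagGroup_mem_unitary he hee hsum
  have hGn : ∀ t, ‖G t‖ = ‖u‖ := fun t => by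
    rw [hG, CStarRing.norm_mul_mem_unitary _ (hU _), CStarRing.norm_mem_unitary_mul _ (hU _)]
  have hint : Integrable fun t => f t • G t := by
    refine (hf.norm.mul_const ‖u‖).mono' (hf.aestronglyMeasurable.smul
      hGc.aestronglyMeasurable) (.of_forall fun t => ?_)
    rw [norm_smul, hGn]
  refine ⟨∫ t, f t • G t, ?_, fun r hr s hs hrs => ?_⟩
  · have hu : u = ∫ t, f t • u := by rw [integral_smul_const, hf0, one_smul]
    have hint2 : Integrable fun t => f t • u := hf.smul_const u
    have : (∫ t, f t • G t) - u = ∫ t, f t • (G t - u) := by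
      conv_lhs => rw [hu]
      rw [← integral_sub hint hint2]
      simp only [smul_sub]
    rw [this]
    have h2 : 2 * Real.pi * (∫ t, |t| * ‖f t‖) * ‖h * u - u * h‖ =
        ∫ t, |t| * ‖f t‖ * (2 * Real.pi * ‖h * u - u * h‖) := by
      rw [integral_mul_const]; ring
    rw [h2]
    refine norm_integral_le_of_norm_le (hf1.mul_const _) (.of_forall fun t => ?_)
    rw [norm_smul]
    refine (mul_le_mul_of_nonneg_left (norm_diagGroup_conj_sub_le he hee hsum hh t)
      (norm_nonneg _)).trans (le_of_eq (by ring))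
  · let L : A →L[ℂ] A := (ContinuousLinearMap.mul ℂ A).flip (e s) ∘L ContinuousLinearMap.mul ℂ A (e r)
    have hL : ∀ y, L y = e r * y * e s := fun y => rfl
    rw [← hL, ← L.integral_comp_comm hint]
    have : ∀ t, L (f t • G t) =
        (Complex.exp (↑(-2 * Real.pi * t * (r - s)) * Complex.I) * f t) • (e r * u * e s) := by
      intro t
      have h1 : e r * G t * e s = (e r * diagGroup I e t) * u * (diagGroup I e (-t) * e s) := by
        simp only [hG, mul_assoc]
      rw [map_smul, hL, h1, diagGroup, diagGroup, mul_sum_smul_of_mem he hee _ hr,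
        sum_smul_mul_of_mem he hee _ hs, smul_mul_assoc, smul_mul_assoc, mul_smul_comm, smul_smul,
        smul_smul, mul_assoc (f t), ← Complex.exp_add, ← add_mul, ← Complex.ofReal_add,
        mul_comm (f t)]
      congr 5
      ring
    simp only [this]
    rw [integral_smul_const, hfw _ hrs, zero_smul]

section SpectralProjection

variable {A : Type*} [CStarAlgebra A]

/-- The spectral projection of `h` for the set `S`; meaningful when `h` has finite spectrum. -/
noncomputable def specProj (h : A) (S : Set ℝ) : A := cfc (S.indicator (1 : ℝ → ℝ)) h

lemma specProj_empty (h : A) : specProj h ∅ = 0 := by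
  simp [specProj]

lemma specProj_univ {h : A} (hh : IsSelfAdjoint h) : specProj h Set.univ = 1 := by
  rw [specProj, Set.indicator_univ, cfc_one ℝ h]

variable [FiniteDimensional ℂ A]

lemma isStarProjection_specProj (h : A) (S : Set ℝ) : IsStarProjection (specProj h S) := by
  have hc : ∀ f : ℝ → ℝ, ContinuousOn f (spectrum ℝ h) := (finite_spectrum_real h).continuousOn
  refine ⟨?_, cfc_predicate _ h⟩
  rw [IsIdempotentElem, specProj, ← cfc_mul _ _ h (hc _) (hc _)]
  refine cfc_congr fun s _ => ?_
  by_cases hs : s ∈ S <;> simp [hs]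

lemma specProj_mul (h : A) (S T : Set ℝ) : specProj h S * specProj h T = specProj h (S ∩ T) := by
  have hc : ∀ f : ℝ → ℝ, ContinuousOn f (spectrum ℝ h) := (finite_spectrum_real h).continuousOn
  rw [specProj, specProj, specProj, ← cfc_mul _ _ h (hc _) (hc _)]
  refine cfc_congr fun s _ => ?_
  by_cases hs : s ∈ S <;> by_cases ht : s ∈ T <;> simp [hs, ht]

lemma specProj_mul_of_subset {h : A} {S T : Set ℝ} (hST : S ⊆ T) :
    specProj h S * specProj h T = specProj h S := by
  rw [specProj_mul, Set.inter_eq_left.2 hST]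

lemma specProj_mul_of_subset' {h : A} {S T : Set ℝ} (hST : S ⊆ T) :
    specProj h T * specProj h S = specProj h S := by
  rw [specProj_mul, Set.inter_eq_right.2 hST]

lemma specProj_mul_of_disjoint {h : A} {S T : Set ℝ} (hST : Disjoint S T) :
    specProj h S * specProj h T = 0 := by
  rw [specProj_mul, hST.inter_eq, specProj_empty]

lemma specProj_add {h : A} {S T : Set ℝ} (hST : Disjoint S T) :
    specProj h S + specProj h T = specProj h (S ∪ T) := by
  have hc : ∀ f : ℝ → ℝ, ContinuousOn f (spectrum ℝ h) := (finite_spectrum_real h).continuousOn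
  rw [specProj, specProj, specProj, ← cfc_add h _ _ (hc _) (hc _)]
  refine cfc_congr fun s _ => ?_
  have : s ∈ S → s ∉ T := fun h1 h2 => Set.disjoint_left.1 hST h1 h2
  by_cases hs : s ∈ S <;> by_cases ht : s ∈ T <;> simp_all

lemma specProj_sub {h : A} {S T : Set ℝ} (hST : T ⊆ S) :
    specProj h S - specProj h T = specProj h (S \ T) := by
  rw [sub_eq_iff_eq_add, specProj_add Set.disjoint_sdiff_left, Set.sdiff_union_of_subset hST]

lemma one_sub_specProj {h : A} (hh : IsSelfAdjoint h) (S : Set ℝ) :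
    1 - specProj h S = specProj h Sᶜ := by
  rw [← specProj_univ hh, specProj_sub (Set.subset_univ S), Set.compl_eq_univ_sdiff]

lemma cfc_comp_eq_sum {κ : Type*} (h : A) (g : ℝ → κ) (G : κ → ℝ)
    {I : Finset κ} (hI : ∀ s ∈ spectrum ℝ h, g s ∈ I) :
    cfc (fun s => G (g s)) h = ∑ k ∈ I, G k • specProj h (g ⁻¹' {k}) := by
  classical
  have hc : ∀ f : ℝ → ℝ, ContinuousOn f (spectrum ℝ h) := (finite_spectrum_real h).continuousOn
  have : ∀ k ∈ I, G k • specProj h (g ⁻¹' {k}) =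
      cfc (fun s => G k * (g ⁻¹' {k}).indicator 1 s) h := fun k _ => by
    rw [specProj, cfc_const_mul _ _ _ (hc _)]
  rw [Finset.sum_congr rfl this, ← cfc_sum _ _ _ fun _ _ => hc _]
  refine cfc_congr fun s hs => ?_
  rw [Finset.sum_apply, Finset.sum_eq_single_of_mem (g s) (hI s hs) fun k _ hk => by
    rw [Set.indicator_of_notMem (by simpa using hk.symm), mul_zero]]
  rw [Set.indicator_of_mem (by simp)]
  simp

lemma sum_specProj {κ : Type*} {h : A} (hh : IsSelfAdjoint h) (g : ℝ → κ)
    {I : Finset κ} (hI : ∀ s ∈ spectrum ℝ h, g s ∈ I) :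
    ∑ k ∈ I, specProj h (g ⁻¹' {k}) = 1 := by
  have := cfc_comp_eq_sum h g (fun _ => 1) hI
  rw [cfc_const_one ℝ h] at this
  simpa using this.symm

lemma commute_cfc_comp {κ : Type*} (h : A) (g : ℝ → κ) (G : κ → ℝ)
    {w : A} (hw : ∀ k, Commute w (specProj h (g ⁻¹' {k}))) :
    Commute w (cfc (fun s => G (g s)) h) := by
  classical
  rw [cfc_comp_eq_sum h g G (I := (finite_spectrum_real h).toFinset.image g) fun s hs =>
    Finset.mem_image_of_mem g ((Set.Finite.mem_toFinset _).2 hs)]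
  exact Commute.sum_right _ _ _ fun k _ => (hw k).smul_right _

lemma disjoint_preimage_singleton {κ : Type*} (g : ℝ → κ) {k l : κ} (hkl : k ≠ l) :
    Disjoint (g ⁻¹' {k}) (g ⁻¹' {l}) :=
  (Set.disjoint_singleton.2 hkl).preimage g

end SpectralProjection

lemma exists_specProj_band_limited_near : ∃ C : ℝ, 0 ≤ C ∧ ∀ (A : Type*) [CStarAlgebra A]
    [FiniteDimensional ℂ A] (h u : A), IsSelfAdjoint h →
    ∃ x, ‖x - u‖ ≤ C * ‖h * u - u * h‖ ∧ ∀ S T : Set ℝ, (∀ s ∈ S, ∀ t ∈ T, 1 ≤ |s - t|) →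
      specProj h S * x * specProj h T = 0 := by
  obtain ⟨C, hC, H⟩ := exists_band_limited_near
  refine ⟨C, hC, fun A _ _ h u hh => ?_⟩
  set I := (finite_spectrum_real h).toFinset with hI
  have hIs : ∀ s ∈ spectrum ℝ h, id s ∈ I := fun s hs => (Set.Finite.mem_toFinset _).2 hs
  have hsum := sum_specProj hh id hIs
  obtain ⟨x, hx, hxb⟩ := H A I (fun r => specProj h (id ⁻¹' {r}))
    (fun r => isStarProjection_specProj h _)
    (fun r s hrs => specProj_mul_of_disjoint (disjoint_preimage_singleton id hrs)) hsum h u (by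
      conv_lhs => rw [← cfc_id' ℝ h]
      rw [show (fun x : ℝ => x) = fun s => (fun r => r) (id s) from rfl,
        cfc_comp_eq_sum h id (fun r => r) hIs]
      simp only [Complex.coe_smul])
  refine ⟨x, hx, fun S T hST => ?_⟩
  have hz : specProj h S * x * specProj h T = ∑ r ∈ I, ∑ s ∈ I,
      specProj h S * specProj h (id ⁻¹' {r}) * x *
        (specProj h (id ⁻¹' {s}) * specProj h T) := by
    calc specProj h S * x * specProj h T = specProj h S * (∑ r ∈ I, specProj h (id ⁻¹' {r})) * x *
          ((∑ r ∈ I, specProj h (id ⁻¹' {r})) * specProj h T) := by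
          rw [hsum, mul_one, one_mul]
      _ = _ := by
          simp only [Finset.mul_sum, Finset.sum_mul]
          rw [Finset.sum_comm]
  rw [hz]
  refine Finset.sum_eq_zero fun r hr => Finset.sum_eq_zero fun s hs => ?_
  by_cases hrS : r ∈ S
  · by_cases hsT : s ∈ T
    · rw [specProj_mul_of_subset' (by simpa using hrS), specProj_mul_of_subset (by simpa using hsT)]
      exact hxb r hr s hs (hST r hrS s hsT)
    · rw [specProj_mul_of_disjoint (S := id ⁻¹' {s}) (by simpa using hsT), mul_zero]
  · rw [specProj_mul_of_disjoint (T := id ⁻¹' {r}) (by simpa using hrS), zero_mul, zero_mul]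

section BlockDiagonal

variable {A : Type*} [CStarAlgebra A]

/-- Gluing unitaries along an orthogonal family of projections they commute with. -/
lemma exists_unitary_of_blocks {κ : Type*} {I : Finset κ} {E W : κ → A}
    (hE : ∀ k, IsStarProjection (E k)) (hEE : ∀ k l, k ≠ l → E k * E l = 0)
    (hsum : ∑ k ∈ I, E k = 1) (hW : ∀ k, W k ∈ unitary A) (hWE : ∀ k, Commute (W k) (E k)) :
    ∃ V ∈ unitary A, ∀ k, E k * V = E k * W k ∧ V * E k = E k * W k := by
  classical
  have hI : ∀ k, k ∉ I → E k = 0 := fun k hk => by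
    rw [← mul_one (E k), ← hsum, Finset.mul_sum]
    exact Finset.sum_eq_zero fun l hl => hEE k l fun h => hk (h ▸ hl)
  have hWs : ∀ k, Commute (star (W k)) (E k) := fun k => by
    have := congrArg star (hWE k).eq
    rw [star_mul, star_mul, (hE k).isSelfAdjoint.star_eq] at this
    exact this.symm
  have key : ∀ X : κ → A, (∀ k, Commute (X k) (E k)) → ∀ k, E k * (∑ l ∈ I, E l * X l) =
      E k * X k ∧ (∑ l ∈ I, E l * X l) * E k = E k * X k := fun X hX k => by
    by_cases hk : k ∈ I
    · constructor
      · rw [Finset.mul_sum, Finset.sum_eq_single_of_mem k hk fun l _ hl => by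
          rw [← mul_assoc, hEE k l hl.symm, zero_mul]]
        rw [← mul_assoc, (hE k).isIdempotentElem.eq]
      · rw [Finset.sum_mul, Finset.sum_eq_single_of_mem k hk fun l _ hl => by
          rw [← (hX l).eq, mul_assoc, hEE l k hl, mul_zero]]
        rw [← (hX k).eq, mul_assoc, (hE k).isIdempotentElem.eq]
    · simp [hI k hk]
  have hmul : ∀ X Y : κ → A, (∀ k, Commute (X k) (E k)) → (∀ k, Commute (Y k) (E k)) →
      (∀ k, X k * Y k = 1) → (∑ l ∈ I, E l * X l) * (∑ l ∈ I, E l * Y l) = 1 :=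
    fun X Y hX hY hXY => by
      rw [Finset.mul_sum, ← hsum]
      refine Finset.sum_congr rfl fun k _ => ?_
      rw [← mul_assoc, (key X hX k).2, mul_assoc, hXY, mul_one]
  have hstar : star (∑ l ∈ I, E l * W l) = ∑ l ∈ I, E l * star (W l) := by
    rw [star_sum]
    refine Finset.sum_congr rfl fun k _ => ?_
    rw [star_mul, (hE k).isSelfAdjoint.star_eq, (hWs k).eq]
  refine ⟨∑ l ∈ I, E l * W l, ?_, key W hWE⟩
  rw [Unitary.mem_iff, hstar]
  exact ⟨hmul _ _ hWs hWE fun k => (Unitary.mem_iff.1 (hW k)).1,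
    hmul _ _ hWE hWs fun k => (Unitary.mem_iff.1 (hW k)).2⟩

/-- If a unitary `y` is almost block diagonal in the sense that its off-diagonal columns are small
and supported near the diagonal, then it is close to a block diagonal unitary. -/
lemma exists_unitary_near_of_off_diagonal {I : Finset ℤ} {F G : ℤ → A} {y z : A} {η : ℝ}
    (hF : ∀ k, IsStarProjection (F k)) (hFF : ∀ k l, k ≠ l → F k * F l = 0)
    (hsum : ∑ k ∈ I, F k = 1) (hG : ∀ k, IsStarProjection (G k))
    (hGG : ∀ k l, k ≠ l → (Even k ↔ Even l) → G k * G l = 0)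
    (hGD : ∀ k, G k * ((1 - F k) * (z * F k)) = (1 - F k) * (z * F k))
    (hD : ∀ k, ‖(1 - F k) * (z * F k)‖ ≤ 17 * η)
    (hy : y ∈ unitary A) (hzy : ‖z - y‖ ≤ η) (hη : η ≤ 1 / 100) :
    ∃ V ∈ unitary A, ‖V - y‖ ≤ 140 * η ∧ ∀ k, Commute V (F k) := by
  have hη0 : 0 ≤ η := (norm_nonneg _).trans hzy
  have hI : ∀ k, k ∉ I → F k = 0 := fun k hk => by
    rw [← mul_one (F k), ← hsum, Finset.mul_sum]
    exact Finset.sum_eq_zero fun l hl => hFF k l fun h => hk (h ▸ hl)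
  set V₀ := ∑ k ∈ I, F k * (z * F k) with hV₀
  have hzV : z - V₀ = ∑ k ∈ I, (1 - F k) * (z * F k) := by
    rw [hV₀]
    simp only [sub_mul, one_mul, Finset.sum_sub_distrib, ← Finset.mul_sum, hsum, mul_one]
  have h1 : ‖z - V₀‖ ≤ 2 * (17 * η) := by
    rw [hzV]
    refine norm_sum_le_of_orthogonal_of_parity I F _ (by positivity) hF hFF (fun k => ?_)
      (fun k l hkl hp => ?_) hD
    · rw [mul_assoc, mul_assoc, (hF k).isIdempotentElem.eq]
    · rw [← hGD k, ← hGD l, star_mul, (hG k).isSelfAdjoint.star_eq, mul_assoc, ← mul_assoc (G k),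
        hGG k l hkl hp, zero_mul, mul_zero]
  have h2 : ‖V₀ - y‖ ≤ 35 * η := by
    have := norm_sub_le (z - y) (z - V₀)
    rw [sub_sub_sub_cancel_left] at this
    linarith
  have hc : ∀ k, Commute V₀ (F k) := fun k => by
    by_cases hk : k ∈ I
    · rw [Commute, SemiconjBy, hV₀, Finset.mul_sum, Finset.sum_mul,
        Finset.sum_eq_single_of_mem k hk fun l _ hl => by
          rw [mul_assoc, mul_assoc, hFF l k hl, mul_zero, mul_zero],
        Finset.sum_eq_single_of_mem k hk fun l _ hl => by
          rw [← mul_assoc, hFF k l hl.symm, zero_mul]]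
      simp only [mul_assoc, (hF k).isIdempotentElem.eq]
      rw [← mul_assoc (F k) (F k), (hF k).isIdempotentElem.eq]
    · rw [hI k hk]; exact Commute.zero_right _
  have hcs : ∀ k, Commute (star V₀) (F k) := fun k => by
    have := congrArg star (hc k).eq
    rw [star_mul, star_mul, (hF k).isSelfAdjoint.star_eq] at this
    exact this.symm
  obtain ⟨s, hs, hsc, hsn⟩ := exists_polar_of_norm_sub_le hy h2 (by linarith)
  exact ⟨V₀ * s, hs, by linarith, fun k => (hc k).mul_left (hsc _ ((hcs k).mul_left (hc k)))⟩

variable [FiniteDimensional ℂ A]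

lemma exists_block_factorization {h u x : A} {η : ℝ} (hh : IsSelfAdjoint h) (hu : u ∈ unitary A)
    (hxu : ‖x - u‖ ≤ η) (hη : η ≤ 1 / 100)
    (hx : ∀ S T : Set ℝ, (∀ s ∈ S, ∀ t ∈ T, 1 ≤ |s - t|) → specProj h S * x * specProj h T = 0) :
    ∃ W ∈ unitary A, ∃ V ∈ unitary A, ‖V - W * u‖ ≤ 140 * η ∧
      (∀ k : ℤ, Commute W (specProj h ((fun s : ℝ => ⌊s / 2⌋) ⁻¹' {k}))) ∧
      ∀ k : ℤ, Commute V (specProj h ((fun s : ℝ => ⌊(s + 1) / 2⌋) ⁻¹' {k})) := by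
  have hη0 : 0 ≤ η := (norm_nonneg _).trans hxu
  have hp := isStarProjection_specProj h
  have hp1 : ∀ S, ‖specProj h S‖ ≤ 1 := fun S => norm_le_one_of_isStarProjection (hp S)
  have hux : ∀ S T : Set ℝ, (∀ s ∈ S, ∀ t ∈ T, 1 ≤ |s - t|) →
      ‖specProj h S * (u * specProj h T)‖ ≤ η := fun S T hST => by
    have : specProj h S * (u * specProj h T) = -(specProj h S * ((x - u) * specProj h T)) := by
      rw [sub_mul, mul_sub, ← mul_assoc _ x, hx S T hST, zero_sub, neg_neg]
    rw [this, norm_neg]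
    exact (norm_mul_le _ _).trans ((mul_le_of_le_one_left (norm_nonneg _) (hp1 S)).trans
      ((norm_mul_le _ _).trans ((mul_le_of_le_one_right (norm_nonneg _) (hp1 T)).trans hxu)))
  set E : ℤ → A := fun k => specProj h ((fun s : ℝ => ⌊s / 2⌋) ⁻¹' {k}) with hE
  set F : ℤ → A := fun k => specProj h ((fun s : ℝ => ⌊(s + 1) / 2⌋) ⁻¹' {k}) with hF
  set P : ℤ → A := fun k => specProj h (Set.Iio (2 * k + 1)) with hP
  set e : ℤ → A := fun k => specProj h (Set.Iio (2 * k)) with he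
  have hEfe : ∀ k, E k = e (k + 1) - e k := fun k => by
    rw [hE, he]
    simp only
    rw [specProj_sub (Set.Iio_subset_Iio (by push_cast; linarith))]
    congr 1
    ext s
    simp only [Set.mem_preimage, Set.mem_singleton_iff, Int.floor_eq_iff, Set.mem_sdiff,
      Set.mem_Iio, not_lt]
    push_cast
    constructor <;> rintro ⟨h1, h2⟩ <;> constructor <;> linarith
  have hFPP : ∀ k, F k = P k - P (k - 1) := fun k => by
    rw [hF, hP]
    simp only
    rw [specProj_sub (Set.Iio_subset_Iio (by push_cast; linarith))]
    congr 1
    ext s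
    simp only [Set.mem_preimage, Set.mem_singleton_iff, Int.floor_eq_iff, Set.mem_sdiff,
      Set.mem_Iio, not_lt]
    push_cast
    constructor <;> rintro ⟨h1, h2⟩ <;> constructor <;> linarith
  have hcut : ∀ k, ∃ W R : A, W ∈ unitary A ∧ W * R = P k * W ∧ Commute W (E k) ∧
      R = e k + E k * R ∧ ‖R - u * P k * star u‖ ≤ 8 * η := fun k => by
    simp only [hEfe]
    have s1 : Set.Iio (2 * k : ℝ) ⊆ Set.Iio (2 * k + 1) := Set.Iio_subset_Iio (by linarith)
    have s2 : Set.Iio (2 * k + 1 : ℝ) ⊆ Set.Iio (2 * (k + 1 : ℤ)) :=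
      Set.Iio_subset_Iio (by push_cast; linarith)
    refine exists_unitary_undoing_cut hu (hp _) (hp _) (hp _) (specProj_mul_of_subset s1)
      (specProj_mul_of_subset' s1) (specProj_mul_of_subset s2) (specProj_mul_of_subset' s2)
      ?_ ?_ hη
    · rw [one_sub_specProj hh]
      refine hux _ _ fun s hs t ht => ?_
      simp only [Set.mem_Iio, Set.mem_compl_iff, not_lt] at hs ht
      rw [abs_sub_comm]
      exact le_trans (by linarith) (le_abs_self _)
    · rw [one_sub_specProj hh]
      refine hux _ _ fun s hs t ht => ?_
      simp only [Set.mem_Iio, Set.mem_compl_iff, not_lt] at hs ht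
      push_cast at hs
      exact le_trans (by linarith) (le_abs_self _)
  choose W₀ R hW₀ hWR hWE hRe hRn using hcut
  have hEE : ∀ k l, k ≠ l → E k * E l = 0 := fun k l hkl =>
    specProj_mul_of_disjoint (disjoint_preimage_singleton _ hkl)
  have hFF : ∀ k l, k ≠ l → F k * F l = 0 := fun k l hkl =>
    specProj_mul_of_disjoint (disjoint_preimage_singleton _ hkl)
  have hfin := finite_spectrum_real h
  have hsum : ∀ g : ℝ → ℤ,
      ∑ k ∈ hfin.toFinset.image g, specProj h (g ⁻¹' {k}) = 1 := fun g =>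
    sum_specProj hh g fun s hs => Finset.mem_image_of_mem g (hfin.mem_toFinset.2 hs)
  obtain ⟨W, hW, hWW⟩ := exists_unitary_of_blocks (fun k => hp _) hEE (hsum _) hW₀ hWE
  have hWcE : ∀ k, Commute W (E k) := fun k => (hWW k).2.trans (hWW k).1.symm
  have hWce : ∀ k, Commute W (e k) := fun k => by
    have := commute_cfc_comp h (fun s : ℝ => ⌊s / 2⌋) (fun j => if j < k then 1 else 0) hWcE
    rw [he]
    simp only [specProj]
    refine (congrArg (fun f : ℝ → ℝ => Commute W (cfc f h)) (funext fun s => ?_)).mpr this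
    have : s < 2 * k ↔ ⌊s / 2⌋ < k := by
      rw [Int.floor_lt]; constructor <;> intro _ <;> linarith
    by_cases hs : s < 2 * k
    · rw [if_pos (this.1 hs), Set.indicator_of_mem (Set.mem_Iio.2 hs), Pi.one_apply]
    · rw [if_neg (this.not.1 hs), Set.indicator_of_notMem (by simpa using hs)]
  have hWRP : ∀ k, W * R k = P k * W := fun k => by
    have hPe : P k * e k = e k :=
      specProj_mul_of_subset' (Set.Iio_subset_Iio (by linarith))
    have hPe' : P k * e (k + 1) = P k :=
      specProj_mul_of_subset (Set.Iio_subset_Iio (by push_cast; linarith))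
    have hPE : P k * E k = E k * P k := by
      simp only [hP, hE, specProj_mul, Set.inter_comm]
    calc W * R k = W * e k + (W * E k) * R k := by
          conv_lhs => rw [hRe k, mul_add, ← mul_assoc]
      _ = e k * W + E k * (W₀ k * R k) := by rw [(hWce k).eq, (hWW k).2, mul_assoc]
      _ = e k * W + (P k * E k) * W₀ k := by rw [hWR k, ← mul_assoc, hPE]
      _ = (e k + P k * E k) * W := by rw [mul_assoc, ← (hWW k).1, ← mul_assoc, add_mul]
      _ = P k * W := by rw [hEfe, mul_sub, hPe, hPe', add_sub_cancel]
  set y := W * u with hy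
  have hyu : y ∈ unitary A := mul_mem hW hu
  have hyP : ∀ k, ‖y * P k * star y - P k‖ ≤ 8 * η := fun k => by
    have : y * P k * star y - P k = -(W * (R k - u * P k * star u) * star W) := by
      have h1 : W * (R k - u * P k * star u) * star W = W * R k * star W - y * P k * star y := by
        rw [hy, star_mul]; noncomm_ring
      rw [h1, hWRP, mul_assoc (P k), (Unitary.mem_iff.1 hW).2, mul_one, neg_sub]
    rw [this, norm_neg, CStarRing.norm_mul_mem_unitary _ (Unitary.star_mem hW),
      CStarRing.norm_mem_unitary_mul _ hW]
    exact hRn k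
  have hyF : ∀ k, ‖(1 - F k) * (y * F k)‖ ≤ 16 * η := fun k => by
    have h1 : (1 - F k) * (y * F k) = (1 - F k) * (y * F k * star y - F k) * y := by
      have h2 : (1 - F k) * (y * F k * star y - F k) * y =
          (1 - F k) * (y * F k * (star y * y)) - (F k - F k * F k) * y := by noncomm_ring
      rw [h2, (hp _).isIdempotentElem.eq, (Unitary.mem_iff.1 hyu).1, sub_self, zero_mul, sub_zero,
        mul_one]
    rw [h1, CStarRing.norm_mul_mem_unitary _ hyu]
    refine (norm_mul_le _ _).trans ((mul_le_of_le_one_left (norm_nonneg _)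
      (norm_le_one_of_isStarProjection (hp _).one_sub)).trans ?_)
    have h3 : y * F k * star y - F k =
        (y * P k * star y - P k) - (y * P (k - 1) * star y - P (k - 1)) := by
      rw [hFPP]; noncomm_ring
    rw [h3]
    have := norm_sub_le (y * P k * star y - P k) (y * P (k - 1) * star y - P (k - 1))
    linarith [hyP k, hyP (k - 1)]
  have hzy : ‖W * x - y‖ ≤ η := by
    rwa [hy, ← mul_sub, CStarRing.norm_mem_unitary_mul _ hW]
  set G : ℤ → A := fun k => specProj h (Set.Ico (2 * k - 2) (2 * k + 2)) with hG
  have hGE : ∀ k, G k = e (k + 1) - e (k - 1) := fun k => by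
    rw [hG, he]
    simp only
    rw [specProj_sub (Set.Iio_subset_Iio (by push_cast; linarith))]
    congr 1
    ext s
    simp only [Set.mem_Ico, Set.mem_sdiff, Set.mem_Iio, not_lt]
    push_cast
    constructor <;> rintro ⟨h1, h2⟩ <;> constructor <;> linarith
  have hWcG : ∀ k, Commute W (G k) := fun k => by
    rw [hGE]; exact (hWce _).sub_right (hWce _)
  have hGG : ∀ k l, k ≠ l → (Even k ↔ Even l) → G k * G l = 0 := fun k l hkl hpar => by
    refine specProj_mul_of_disjoint (Set.disjoint_left.2 fun s hs ht => hkl ?_)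
    simp only [Set.mem_Ico] at hs ht
    have h1 : k < l + 2 := by
      have : (k : ℝ) < l + 2 := by linarith
      exact_mod_cast this
    have h2 : l < k + 2 := by
      have : (l : ℝ) < k + 2 := by linarith
      exact_mod_cast this
    rw [Int.even_iff, Int.even_iff] at hpar
    omega
  have hGD : ∀ k, G k * ((1 - F k) * (W * x * F k)) = (1 - F k) * (W * x * F k) := fun k => by
    have hGF : Commute (G k) (F k) := by
      rw [Commute, SemiconjBy, hG, hF]
      simp only [specProj_mul, Set.inter_comm]
    have hGx : G k * (x * F k) = x * F k := by
      have : (1 - G k) * x * F k = 0 := by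
        rw [hG, hF]
        simp only
        rw [one_sub_specProj hh]
        refine hx _ _ fun s hs t ht => ?_
        simp only [Set.mem_preimage, Set.mem_singleton_iff, Int.floor_eq_iff, Set.mem_Ico,
          Set.mem_compl_iff, not_and, not_lt] at hs ht
        by_cases hs' : 2 * (k : ℝ) - 2 ≤ s
        · exact le_trans (by linarith [hs hs']) (le_abs_self _)
        · rw [abs_sub_comm]
          exact le_trans (by linarith) (le_abs_self _)
      rw [sub_mul, sub_mul, one_mul, sub_eq_zero] at this
      rw [← mul_assoc, ← this]
    have hG1 : G k * (1 - F k) = (1 - F k) * G k := by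
      rw [mul_sub, sub_mul, hGF.eq, mul_one, one_mul]
    rw [← mul_assoc, hG1, mul_assoc, mul_assoc W, ← mul_assoc (G k) W, ← (hWcG k).eq,
      mul_assoc W, hGx]
  have hD : ∀ k, ‖(1 - F k) * (W * x * F k)‖ ≤ 17 * η := fun k => by
    have : (1 - F k) * (W * x * F k) =
        (1 - F k) * (y * F k) + (1 - F k) * ((W * x - y) * F k) := by noncomm_ring
    rw [this]
    refine (norm_add_le _ _).trans ?_
    have h1 : ‖(1 - F k) * ((W * x - y) * F k)‖ ≤ η :=
      (norm_mul_le _ _).trans ((mul_le_of_le_one_left (norm_nonneg _)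
        (norm_le_one_of_isStarProjection (hp _).one_sub)).trans
      ((norm_mul_le _ _).trans ((mul_le_of_le_one_right (norm_nonneg _) (hp1 _)).trans hzy)))
    linarith [hyF k]
  obtain ⟨V, hV, hVy, hVF⟩ := exists_unitary_near_of_off_diagonal (fun k => hp _) hFF (hsum _)
    (fun k => hp _) hGG hGD hD hyu hzy hη
  exact ⟨W, hW, V, hV, hVy, hWcE, hVF⟩

end BlockDiagonal

section FiniteDimensionalPath

lemma IsUnitaryPath.mono {A : Type*} [CStarAlgebra A] {K L : ℝ} {p : ℝ → A}
    (hp : IsUnitaryPath K p) (hKL : K ≤ L) : IsUnitaryPath L p where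
  mem_unitary := hp.mem_unitary
  norm_sub_le s hs t ht := (hp.norm_sub_le s hs t ht).trans
    (mul_le_mul_of_nonneg_right hKL (abs_nonneg _))

variable {A : Type*} [CStarAlgebra A] [FiniteDimensional ℂ A]

lemma norm_commutator_le_of_commute_cfc {h x : A} (hh : IsSelfAdjoint h) (hx : ‖x‖ ≤ 1)
    {g : ℝ → ℝ} (hg : ∀ s, |s - g s| ≤ 2) (hxg : Commute x (cfc g h)) :
    ‖h * x - x * h‖ ≤ 4 := by
  have hc : ∀ f : ℝ → ℝ, ContinuousOn f (spectrum ℝ h) := (finite_spectrum_real h).continuousOn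
  have h1 : ‖h - cfc g h‖ ≤ 2 := by
    have : h - cfc g h = cfc (fun s => s - g s) h := by
      rw [cfc_sub _ _ h (hc _) (hc _), cfc_id' ℝ h]
    rw [this]
    exact norm_cfc_le zero_le_two fun s _ => hg s
  have h2 : h * x - x * h = (h - cfc g h) * x - x * (h - cfc g h) := by
    rw [sub_mul, mul_sub, hxg.eq]; abel
  rw [h2]
  linarith [norm_commutator_le (h - cfc g h) x hx]

lemma abs_sub_floor_half_le (s : ℝ) : |s - 2 * (⌊s / 2⌋ : ℝ)| ≤ 2 := by
  have h1 := Int.floor_le (s / 2)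
  have h2 := Int.lt_floor_add_one (s / 2)
  rw [abs_le]; constructor <;> linarith

lemma abs_sub_floor_half_add_le (s : ℝ) : |s - 2 * (⌊(s + 1) / 2⌋ : ℝ)| ≤ 2 := by
  have h1 := Int.floor_le ((s + 1) / 2)
  have h2 := Int.lt_floor_add_one ((s + 1) / 2)
  rw [abs_le]; constructor <;> linarith

/-- A block diagonal unitary is joined to `1` by a short path of block diagonal unitaries. -/
lemma exists_path_of_commute_cfc {h w : A} (hh : IsSelfAdjoint h) (hw : w ∈ unitary A)
    {g : ℝ → ℝ} (hg : ∀ s, |s - g s| ≤ 2) (hwg : Commute w (cfc g h)) :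
    ∃ p : ℝ → A, IsUnitaryPath Real.pi p ∧ p 0 = 1 ∧ p 1 = w ∧
      ∀ t ∈ Set.Icc (0 : ℝ) 1, ‖h * p t - p t * h‖ ≤ 4 := by
  obtain ⟨p, hp, hp0, hp1, hpc⟩ := exists_path_of_finite_spectrum hw (finite_spectrum_complex w)
  refine ⟨p, hp, hp0, hp1, fun t ht => norm_commutator_le_of_commute_cfc hh
    (norm_le_one_of_mem_unitary (hp.mem_unitary t ht)) hg (hpc _ hwg ?_ t)⟩
  have h1 : IsSelfAdjoint (cfc g h) := cfc_predicate g h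
  have := congrArg star hwg.eq
  rw [star_mul, star_mul, h1.star_eq] at this
  exact this.symm

end FiniteDimensionalPath

lemma exists_path_of_finiteDimensional (δ : ℝ) (hδ : 0 < δ) : ∃ ν : ℝ, 0 < ν ∧ ν ≤ 1 ∧
    ∀ (A : Type*) [CStarAlgebra A] [FiniteDimensional ℂ A] (h u : A), IsSelfAdjoint h →
      u ∈ unitary A → ‖h * u - u * h‖ ≤ ν →
      ∃ p : ℝ → A, IsUnitaryPath (2 * Real.pi + δ) p ∧ p 0 = 1 ∧ p 1 = u ∧
        ∀ t ∈ Set.Icc (0 : ℝ) 1, ‖h * p t - p t * h‖ ≤ 30 := by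
  obtain ⟨C, hC, H⟩ := exists_specProj_band_limited_near
  set η := min δ 1 / 560 with hη
  have hη0 : 0 < η := by positivity
  have hη1 : 560 * η ≤ δ := by linarith [min_le_left δ 1]
  have hη2 : 560 * η ≤ 1 := by linarith [min_le_right δ 1]
  refine ⟨min 1 (η / (C + 1)), by positivity, min_le_left _ _, fun A _ _ h u hh hu huν => ?_⟩
  have hu1 : ‖h * u - u * h‖ ≤ 1 := huν.trans (min_le_left _ _)
  obtain ⟨x, hxu, hx⟩ := H A h u hh
  have hxη : ‖x - u‖ ≤ η := by
    have h1 : ‖h * u - u * h‖ * (C + 1) ≤ η :=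
      (le_div_iff₀ (by positivity)).1 (huν.trans (min_le_right _ _))
    nlinarith [norm_nonneg (h * u - u * h)]
  obtain ⟨W, hW, V, hV, hVW, hWE, hVF⟩ := exists_block_factorization hh hu hxη (by linarith) hx
  have hcW := commute_cfc_comp h _ (fun k : ℤ => 2 * (k : ℝ)) hWE
  have hcV := commute_cfc_comp h _ (fun k : ℤ => 2 * (k : ℝ)) hVF
  have hcW' : Commute (star W) (cfc (fun s : ℝ => 2 * (⌊s / 2⌋ : ℝ)) h) := by
    have h1 : IsSelfAdjoint (cfc (fun s : ℝ => 2 * (⌊s / 2⌋ : ℝ)) h) := cfc_predicate _ h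
    have := congrArg star hcW.eq
    rw [star_mul, star_mul, h1.star_eq] at this
    exact this.symm
  obtain ⟨pW, hpW, hpW0, hpW1, hpWc⟩ :=
    exists_path_of_commute_cfc hh (Unitary.star_mem hW) abs_sub_floor_half_le hcW'
  obtain ⟨pV, hpV, hpV0, hpV1, hpVc⟩ :=
    exists_path_of_commute_cfc hh hV abs_sub_floor_half_add_le hcV
  set w := star V * (W * u) with hw
  have hwu : w ∈ unitary A := mul_mem (Unitary.star_mem hV) (mul_mem hW hu)
  have hw1 : ‖w - 1‖ ≤ 140 * η := by
    have : w - 1 = star V * (W * u - V) := by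
      rw [mul_sub, ← hw, (Unitary.mem_iff.1 hV).1]
    rwa [this, CStarRing.norm_mem_unitary_mul _ (Unitary.star_mem hV), norm_sub_rev]
  have hhw : ‖h * w - w * h‖ ≤ 9 := by
    have h1 := norm_commutator_mul_le h (star V) (W * u)
      (norm_le_one_of_mem_unitary (Unitary.star_mem hV))
      (norm_le_one_of_mem_unitary (mul_mem hW hu))
    have h2 := norm_commutator_mul_le h W u (norm_le_one_of_mem_unitary hW)
      (norm_le_one_of_mem_unitary hu)
    rw [norm_commutator_star h V hh] at h1
    have h3 := norm_commutator_le_of_commute_cfc hh (norm_le_one_of_mem_unitary hV)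
      abs_sub_floor_half_add_le hcV
    have h4 := norm_commutator_le_of_commute_cfc hh (norm_le_one_of_mem_unitary hW)
      abs_sub_floor_half_le hcW
    linarith
  obtain ⟨pc, hpc, hpc0, hpc1, hpcc⟩ := exists_path_of_norm_sub_one_le hwu hw1 (by linarith)
  refine ⟨fun t => pW t * pV t * pc t, ((hpW.mul hpV).mul hpc).mono (by linarith), ?_, ?_,
    fun t ht => ?_⟩
  · simp [hpW0, hpV0, hpc0]
  · simp only [hpW1, hpV1, hpc1, hw]
    calc star W * V * (star V * (W * u)) = star W * (V * star V) * W * u := by noncomm_ring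
      _ = u := by
        rw [(Unitary.mem_iff.1 hV).2, mul_one, (Unitary.mem_iff.1 hW).1, one_mul]
  · have h1 := norm_commutator_mul_le h (pW t * pV t) (pc t)
      (norm_le_one_of_mem_unitary ((hpW.mul hpV).mem_unitary t ht))
      (norm_le_one_of_mem_unitary (hpc.mem_unitary t ht))
    have h2 := norm_commutator_mul_le h (pW t) (pV t)
      (norm_le_one_of_mem_unitary (hpW.mem_unitary t ht))
      (norm_le_one_of_mem_unitary (hpV.mem_unitary t ht))
    have h3 := hpcc h t ht
    have h4 := hpWc t ht
    have h5 := hpVc t ht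
    linarith

section AF

variable {A : Type*} [CStarAlgebra A]

lemma isClosed_of_finiteDimensional (S : StarSubalgebra ℂ A) [FiniteDimensional ℂ S] :
    IsClosed (S : Set A) := by
  have : FiniteDimensional ℂ S.toSubalgebra.toSubmodule := ‹FiniteDimensional ℂ S›
  exact S.toSubalgebra.toSubmodule.closed_of_finiteDimensional

lemma IsAFAlgebra.exists_approx (hA : IsAFAlgebra A) {h u : A} (hh : IsSelfAdjoint h)
    (hu : u ∈ unitary A) {τ : ℝ} (hτ : 0 < τ) (hτ1 : τ < 1) :
    ∃ S : StarSubalgebra ℂ A, FiniteDimensional ℂ S ∧ ∃ h' u' : S, IsSelfAdjoint h' ∧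
      u' ∈ unitary S ∧ ‖(h' : A) - h‖ ≤ τ ∧ ‖(u' : A) - u‖ ≤ 4 * τ := by
  obtain ⟨S, hS, hfd, hd⟩ := hA
  have happrox : ∀ y : A, ∃ n, ∃ b ∈ S n, ‖b - y‖ < τ := fun y => by
    obtain ⟨b, hb, hby⟩ := hd.exists_dist_lt y hτ
    obtain ⟨n, hn⟩ := Set.mem_iUnion.1 hb
    exact ⟨n, b, hn, by rwa [← dist_eq_norm, dist_comm]⟩
  obtain ⟨m, a, ha, hah⟩ := happrox h
  obtain ⟨n, b, hb, hbu⟩ := happrox u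
  have ha' := hS (le_max_left m n) ha
  have hb' := hS (le_max_right m n) hb
  generalize hT : S (max m n) = T at ha' hb'
  have hTfd : FiniteDimensional ℂ T := hT ▸ hfd _
  have := isClosed_of_finiteDimensional T
  have hbu' : IsUnit (⟨b, hb'⟩ : T) :=
    T.coe_isUnit.1 (isUnit_of_norm_sub_lt_one hu (hbu.trans hτ1))
  obtain ⟨s, hs, -, hsn⟩ := exists_polar_of_isUnit hbu'
  refine ⟨T, hTfd, (2⁻¹ : ℝ) • ((⟨a, ha'⟩ : T) + star ⟨a, ha'⟩), ⟨b, hb'⟩ * s, ?_, hs, ?_, ?_⟩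
  · rw [IsSelfAdjoint, star_smul, star_add, star_star, add_comm]
    simp
  · have : (((2⁻¹ : ℝ) • ((⟨a, ha'⟩ : T) + star ⟨a, ha'⟩) : T) : A) - h =
        (2⁻¹ : ℝ) • ((a - h) + star (a - h)) := by
      have h2 : h = (2⁻¹ : ℝ) • (h + h) := by
        rw [← two_smul ℝ h, smul_smul]; norm_num
      conv_lhs => rw [h2]
      rw [star_sub, hh.star_eq]
      change (2⁻¹ : ℝ) • (a + star a) - _ = _
      rw [← smul_sub]
      congr 1
      abel
    rw [this, norm_smul]
    have h1 := norm_add_le (a - h) (star (a - h))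
    rw [norm_star] at h1
    rw [Real.norm_eq_abs, abs_of_pos (by norm_num : (0 : ℝ) < 2⁻¹)]
    linarith
  · have h0 : ‖1 - star b * b‖ ≤ τ + τ + τ * τ := norm_one_sub_star_mul_self_le hu hbu.le
    have h1 : ‖(⟨b, hb'⟩ : T) * s - ⟨b, hb'⟩‖ ≤ τ + τ + τ * τ := hsn.trans h0
    have h2 : ((⟨b, hb'⟩ * s : T) : A) - u =
        (((⟨b, hb'⟩ : T) * s - ⟨b, hb'⟩ : T) : A) + (b - u) := by
      simp
    rw [h2]
    refine (norm_add_le _ _).trans ?_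
    have h3 : ‖(((⟨b, hb'⟩ : T) * s - ⟨b, hb'⟩ : T) : A)‖ ≤ τ + τ + τ * τ := h1
    nlinarith

lemma IsUnitaryPath.lipschitzOnWith {K : ℝ} {p : ℝ → A} (hp : IsUnitaryPath K p) (hK : 0 ≤ K) :
    LipschitzOnWith K.toNNReal p (Set.Icc 0 1) :=
  LipschitzOnWith.of_dist_le_mul fun s hs t ht => by
    rw [dist_eq_norm, Real.dist_eq, Real.coe_toNNReal K hK]
    exact hp.norm_sub_le s hs t ht

lemma LipschitzOnWith.eVariationOn_Icc_zero_one_le {K : NNReal} {p : ℝ → A}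
    (hp : LipschitzOnWith K p (Set.Icc 0 1)) : eVariationOn p (Set.Icc 0 1) ≤ K := by
  have h1 := hp.comp_eVariationOn_le (g := id) (Set.mapsTo_id _)
  have h2 := (monotoneOn_id (s := Set.Icc (0 : ℝ) 1)).eVariationOn_eq
    (Set.left_mem_Icc.2 zero_le_one) (Set.right_mem_Icc.2 zero_le_one)
  rw [Set.inter_self] at h2
  refine h1.trans ((mul_le_mul_right h2.le _).trans ?_)
  simp

end AF

/-- For every `ε > 0` there exists `ν > 0` (depending only on `ε`) such that for every
unital AF C*-algebra `A`, every unitary `u` and self-adjoint `h` in `A` with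
`‖hu - uh‖ < ν`, there is a continuous path of unitaries from `1` to `u` that
almost commutes with `h` and has length (total variation) at most `3π + ε`. -/
theorem homotopy_lemma_AF :
    ∀ ε : ℝ, 0 < ε → ∃ ν : ℝ, 0 < ν ∧
      ∀ (A : Type*) [CStarAlgebra A], IsAFAlgebra A →
        ∀ u h : A, u ∈ unitary A → IsSelfAdjoint h → ‖h * u - u * h‖ < ν →
          ∃ p : ℝ → A,
            ContinuousOn p (Set.Icc 0 1) ∧
            (∀ t ∈ Set.Icc (0 : ℝ) 1, p t ∈ unitary A) ∧
            p 0 = 1 ∧ p 1 = u ∧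
            (∀ t ∈ Set.Icc (0 : ℝ) 1, ‖h * p t - p t * h‖ < ε) ∧
            eVariationOn p (Set.Icc 0 1) ≤ ENNReal.ofReal (3 * Real.pi + ε) := by
  intro ε hε
  obtain ⟨ν₀, hν₀, -, H⟩ := exists_path_of_finiteDimensional 1 one_pos
  set L := ε / 40 with hL
  have hL0 : 0 < L := by positivity
  refine ⟨ν₀ * L / 2, by positivity, fun A _ hA u h hu hh hhu => ?_⟩
  set c := 2 + 16 * ‖h‖ with hc
  have hc0 : 0 < c := by positivity
  set τ := min (1 / 16) (min (ν₀ * L / 2) (ε / 8) / c) with hτ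
  have hτ0 : 0 < τ := by positivity
  have hτ1 : τ ≤ 1 / 16 := min_le_left _ _
  have hτc : τ * c ≤ min (ν₀ * L / 2) (ε / 8) :=
    (le_div_iff₀ hc0).1 (min_le_right _ _)
  have hτ2 : 2 * τ + 16 * τ * ‖h‖ ≤ ν₀ * L / 2 := by
    have := hτc.trans (min_le_left _ _)
    rw [hc] at this
    linarith
  have hτ3 : 2 * τ + 16 * τ * ‖h‖ ≤ ε / 8 := by
    have := hτc.trans (min_le_right _ _)
    rw [hc] at this
    linarith
  obtain ⟨S, hS, h', u', hh', hu', hh'h, hu'u⟩ := hA.exists_approx hh hu hτ0 (by linarith)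
  have := isClosed_of_finiteDimensional S
  have hu'A : (u' : A) ∈ unitary A := by
    have h1 := congrArg (Subtype.val) (Unitary.mem_iff.1 hu').1
    have h2 := congrArg (Subtype.val) (Unitary.mem_iff.1 hu').2
    exact Unitary.mem_iff.2 ⟨h1, h2⟩
  have hhτ : 0 ≤ τ * ‖h‖ := by positivity
  have hcomm : ‖h' * u' - u' * h'‖ ≤ ν₀ * L := by
    change ‖(h' : A) * u' - u' * h'‖ ≤ ν₀ * L
    have e1 : (h' : A) * u' - u' * h' = (((h' : A) - h) * u' - u' * ((h' : A) - h)) +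
        ((h * u - u * h) + (h * ((u' : A) - u) - ((u' : A) - u) * h)) := by noncomm_ring
    rw [e1]
    have b1 := norm_commutator_le ((h' : A) - h) (u' : A) (norm_le_one_of_mem_unitary hu'A)
    have b2 := norm_add_le (((h' : A) - h) * u' - u' * ((h' : A) - h))
      ((h * u - u * h) + (h * ((u' : A) - u) - ((u' : A) - u) * h))
    have b3 := norm_add_le (h * u - u * h) (h * ((u' : A) - u) - ((u' : A) - u) * h)
    have b4 := norm_sub_le (h * ((u' : A) - u)) (((u' : A) - u) * h)
    have b5 := norm_mul_le h ((u' : A) - u)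
    have b6 := norm_mul_le ((u' : A) - u) h
    have b7 : ‖(u' : A) - u‖ * ‖h‖ ≤ 4 * τ * ‖h‖ := by gcongr
    have b8 : ‖h‖ * ‖(u' : A) - u‖ = ‖(u' : A) - u‖ * ‖h‖ := mul_comm _ _
    linarith
  obtain ⟨p, hp, hp0, hp1, hpc⟩ := H S (L⁻¹ • h') u' (by
      rw [IsSelfAdjoint, star_smul, hh'.star_eq]; simp) hu' (by
      rw [smul_mul_assoc, mul_smul_comm, ← smul_sub, norm_smul, norm_inv, Real.norm_eq_abs,
        abs_of_pos hL0, inv_mul_le_iff₀ hL0]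
      linarith)
  have hpA : IsUnitaryPath (2 * Real.pi + 1) fun t => (p t : A) :=
    ⟨fun t ht => by
      have h1 := congrArg (Subtype.val) (Unitary.mem_iff.1 (hp.mem_unitary t ht)).1
      have h2 := congrArg (Subtype.val) (Unitary.mem_iff.1 (hp.mem_unitary t ht)).2
      exact Unitary.mem_iff.2 ⟨h1, h2⟩, hp.norm_sub_le⟩
  set w := star (u' : A) * u with hw
  have hwu : w ∈ unitary A := mul_mem (Unitary.star_mem hu'A) hu
  have hw1 : ‖w - 1‖ ≤ 4 * τ := by
    have : w - 1 = -(star (u' : A) * ((u' : A) - u)) := by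
      rw [mul_sub, ← hw, (Unitary.mem_iff.1 hu'A).1, neg_sub]
    rwa [this, norm_neg, CStarRing.norm_mem_unitary_mul _ (Unitary.star_mem hu'A)]
  obtain ⟨q, hq, hq0, hq1, hqc⟩ := exists_path_of_norm_sub_one_le hwu hw1 (by linarith)
  have hr := (hpA.mul hq).mono (L := 3 * Real.pi + ε) (by linarith [Real.pi_gt_three])
  have hlip := hr.lipschitzOnWith (by positivity)
  refine ⟨fun t => (p t : A) * q t, hlip.continuousOn, hr.mem_unitary, ?_, ?_, fun t ht => ?_, ?_⟩
  · simp [hp0, hq0]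
  · simp only [hp1, hq1, hw]
    rw [← mul_assoc, (Unitary.mem_iff.1 hu'A).2, one_mul]
  · have h1 : ‖(h' : A) * p t - p t * h'‖ ≤ 30 * L := by
      have := hpc t ht
      rw [smul_mul_assoc, mul_smul_comm, ← smul_sub, norm_smul, norm_inv, Real.norm_eq_abs,
        abs_of_pos hL0, inv_mul_le_iff₀ hL0, mul_comm] at this
      exact this
    have h2 := norm_commutator_le (h - h') (p t : A)
      (norm_le_one_of_mem_unitary (hpA.mem_unitary t ht))
    have h3 : ‖h * p t - p t * h‖ ≤ 30 * L + 2 * τ := by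
      have : h * p t - p t * h = ((h' : A) * p t - p t * h') +
          ((h - h') * p t - p t * (h - h')) := by noncomm_ring
      rw [this]
      rw [norm_sub_rev] at hh'h
      linarith [norm_add_le ((h' : A) * p t - p t * h') ((h - h') * p t - p t * (h - h'))]
    have h4 : ‖h * w - w * h‖ ≤ 8 * τ * ‖h‖ := by
      have : h * w - w * h = h * (w - 1) - (w - 1) * h := by noncomm_ring
      rw [this]
      have b4 := norm_sub_le (h * (w - 1)) ((w - 1) * h)
      have b5 := norm_mul_le h (w - 1)
      have b6 := norm_mul_le (w - 1) h
      have b7 : ‖w - 1‖ * ‖h‖ ≤ 4 * τ * ‖h‖ := by gcongr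
      have b8 : ‖h‖ * ‖w - 1‖ = ‖w - 1‖ * ‖h‖ := mul_comm _ _
      linarith
    have h5 := hqc h t ht
    have h6 := norm_commutator_mul_le h (p t : A) (q t)
      (norm_le_one_of_mem_unitary (hpA.mem_unitary t ht))
      (norm_le_one_of_mem_unitary (hq.mem_unitary t ht))
    linarith
  · exact hlip.eVariationOn_Icc_zero_one_le
end

section
/- Let A be a unital C*-algebra, u ∈ A a unitary, and e ∈ A a projection such that ‖e u (1−e)‖ < 1 and ‖(1−e) u e‖ < 1. Then e u e is invertible in the corner algebra eAe: there exists b ∈ A with b = e b e, b (e u e) = e, and (e u e) b = e. -/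
/-- If `u` is a unitary and `e` a projection with `‖(1-e) u e‖ < 1`, then `e u e` is left invertible
in the corner algebra `eAe`. -/
theorem corner_left_invertible {A : Type*} [CStarAlgebra A]
    {u e : A} (hu : u ∈ unitary A) (he : IsSelfAdjoint e) (he2 : e * e = e)
    (h : ‖(1 - e) * u * e‖ < 1) :
    ∃ b : A, b = e * b * e ∧ b * (e * u * e) = e := by
  set t := (1 - e) * u * e with ht
  have hs : ‖star t * t‖ < 1 := by
    rw [CStarRing.norm_star_mul_self]
    exact mul_lt_one_of_nonneg_of_lt_one_left (norm_nonneg _) h h.le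
  have hte : t * e = t := by simp only [ht, mul_assoc, he2]
  have hstar : star t = e * star u * (1 - e) := by
    simp [ht, star_mul, he.star_eq, mul_assoc]
  have hx : e * star u * e * (e * u * e) = (1 - star t * t) * e := by
    have h1e : (1 - e) * (1 - e) = 1 - e := by
      simp [mul_sub, sub_mul, he2]
    calc e * star u * e * (e * u * e) = e * star u * (e * e) * u * e := by simp only [mul_assoc]
      _ = e * (star u * u) * e - e * star u * (1 - e) * u * e := by rw [he2]; noncomm_ring
      _ = e - e * star u * ((1 - e) * (1 - e)) * u * e := by
        rw [Unitary.star_mul_self_of_mem hu, h1e, mul_one, he2]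
      _ = e - star t * (t * e) := by rw [hte, hstar, ht]; simp only [mul_assoc]
      _ = (1 - star t * t) * e := by rw [sub_mul, one_mul, mul_assoc (star t)]
  have hv : (↑(Units.oneSub (star t * t) hs)⁻¹ : A) * (1 - star t * t) = 1 :=
    (Units.oneSub (star t * t) hs).inv_mul
  refine ⟨e * ↑(Units.oneSub (star t * t) hs)⁻¹ * (e * star u * e), ?_, ?_⟩
  · simp only [← mul_assoc, he2]
    simp only [mul_assoc, he2]
  · rw [mul_assoc, hx, mul_assoc, ← mul_assoc _ _ e, hv, one_mul, he2]

/-- If `u` is a unitary and `e` a projection in a unital C*-algebra with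
`‖e u (1-e)‖ < 1` and `‖(1-e) u e‖ < 1`, then `e u e` is invertible in the
corner algebra `eAe`. -/
theorem corner_invertible {A : Type*} [CStarAlgebra A]
    (u e : A) (hu : u ∈ unitary A) (he : IsSelfAdjoint e) (he2 : e * e = e)
    (h1 : ‖e * u * (1 - e)‖ < 1) (h2 : ‖(1 - e) * u * e‖ < 1) :
    ∃ b : A, b = e * b * e ∧ b * (e * u * e) = e ∧ (e * u * e) * b = e := by
  obtain ⟨b, hb, hbl⟩ := corner_left_invertible hu he he2 h2
  have h1' : ‖(1 - e) * star u * e‖ < 1 := by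
    rw [← norm_star]
    simpa [star_mul, he.star_eq, mul_assoc] using h1
  obtain ⟨c, hc, hcl⟩ := corner_left_invertible (Unitary.star_mem hu) he he2 h1'
  have hcr : e * u * e * star c = e := by
    simpa [star_mul, he.star_eq, mul_assoc] using congrArg star hcl
  have hbe : b * e = b := by rw [hb, mul_assoc, he2]
  have hec : e * star c = star c := by
    have hce : c * e = c := by rw [hc, mul_assoc, he2]
    simpa [star_mul, he.star_eq] using congrArg star hce
  have hbc : b = star c := by rw [← hbe, ← hcr, ← mul_assoc, hbl, hec]
  exact ⟨b, hb, hbl, hbc ▸ hcr⟩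
end

section
/- Let A be a unital C*-algebra, (E_j)_{j∈F} a finite family of pairwise orthogonal projections in A (E_i E_j = 0 for i ≠ j), a > 0, and (c_j)_{j∈F} real numbers with c_j ≥ a for all j. Then for every x ∈ A one has ‖Σ_j c_j x E_j‖ ≥ a · ‖x (Σ_j E_j)‖. -/
/-- For pairwise orthogonal projections `E j`, the element `T = ∑ j, d j • (x * E j)` satisfies
`T * star T = ∑ j, d j ^ 2 • ((x * E j) * star (x * E j))`. -/
theorem sum_smul_mul_projection_mul_star {A : Type*} [CStarAlgebra A] {F : Type*} [Fintype F]
    (E : F → A) (hsa : ∀ j, IsSelfAdjoint (E j)) (horth : ∀ i j, i ≠ j → E i * E j = 0)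
    (d : F → ℝ) (x : A) :
    (∑ j, d j • (x * E j)) * star (∑ j, d j • (x * E j)) =
      ∑ j, d j ^ 2 • ((x * E j) * star (x * E j)) := by
  rw [star_sum, Finset.sum_mul_sum]
  refine Finset.sum_congr rfl fun i _ => ?_
  rw [Finset.sum_eq_single i]
  · rw [star_smul, star_trivial, smul_mul_smul_comm, sq]
  · intro j _ hji
    have h : x * E i * star (x * E j) = 0 := by
      rw [star_mul, (hsa j).star_eq, mul_assoc, ← mul_assoc (E i), horth i j hji.symm, zero_mul,
        mul_zero]
    rw [star_smul, smul_mul_smul_comm, h, smul_zero]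
  · simp

/-- If `(E j)` is a finite family of pairwise orthogonal projections in a unital
C*-algebra, `a > 0` and `c j ≥ a` for all `j`, then for every `x`:
`‖Σ c_j x E_j‖ ≥ a ‖x (Σ E_j)‖`. -/
theorem norm_weighted_sum_ge {A : Type*} [CStarAlgebra A]
    {F : Type*} [Fintype F]
    (E : F → A) (hproj : ∀ j, IsSelfAdjoint (E j) ∧ E j * E j = E j)
    (horth : ∀ i j, i ≠ j → E i * E j = 0)
    (a : ℝ) (ha : 0 < a) (c : F → ℝ) (hc : ∀ j, a ≤ c j) (x : A) :
    a * ‖x * ∑ j, E j‖ ≤ ‖∑ j, c j • (x * E j)‖ := by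
  let _ : PartialOrder A := CStarAlgebra.spectralOrder A
  have _ : StarOrderedRing A := CStarAlgebra.spectralOrderedRing A
  have hsa := fun j => (hproj j).1
  have hsum : ∑ j, a • (x * E j) = a • (x * ∑ j, E j) := by
    rw [Finset.mul_sum, Finset.smul_sum]
  have hle : (∑ j, a • (x * E j)) * star (∑ j, a • (x * E j)) ≤
      (∑ j, c j • (x * E j)) * star (∑ j, c j • (x * E j)) := by
    rw [sum_smul_mul_projection_mul_star E hsa horth (fun _ => a) x,
      sum_smul_mul_projection_mul_star E hsa horth c x]
    refine Finset.sum_le_sum fun j _ => ?_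
    exact smul_le_smul_of_nonneg_right (pow_le_pow_left₀ ha.le (hc j) 2)
      (mul_star_self_nonneg _)
  have hnorm := CStarAlgebra.norm_le_norm_of_nonneg_of_le (mul_star_self_nonneg _) hle
  rw [CStarRing.norm_self_mul_star, CStarRing.norm_self_mul_star, hsum, norm_smul,
    Real.norm_of_nonneg ha.le] at hnorm
  exact (mul_self_le_mul_self_iff (by positivity) (norm_nonneg _)).2 hnorm
end

section
/- Let A be a unital C*-algebra, (E_j)_{j=0}^{m} pairwise orthogonal projections in A with Σ_{j=0}^{m} E_j = 1, let a > 0, and let λ_0, …, λ_m be real numbers with λ_0 − λ_j ≥ a for all j ≥ 1. Set H = Σ_j λ_j E_j, and let u ∈ A be a unitary. Then ‖E_0 u (1 − E_0)‖ ≤ ‖Hu − uH‖ / a. In particular, if ‖Hu − uH‖ < a then ‖E_0 u (1 − E_0)‖ < 1. -/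
theorem sum_smul_mul_sum_smul_of_orthogonal {A ι : Type*} [Ring A] [Algebra ℝ A] [Fintype ι]
    {E : ι → A} (hidem : ∀ j, E j * E j = E j) (horth : ∀ i j, i ≠ j → E i * E j = 0)
    (b c : ι → ℝ) :
    (∑ j, b j • E j) * ∑ j, c j • E j = ∑ j, (b j * c j) • E j := by
  rw [Finset.sum_mul_sum]
  refine Finset.sum_congr rfl fun i _ => ?_
  rw [Finset.sum_eq_single i]
  · rw [smul_mul_smul_comm, hidem]
  · intro j _ hj
    rw [smul_mul_smul_comm, horth i j hj.symm, smul_zero]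
  · simp

theorem norm_sum_smul_le_of_orthogonal {A ι : Type*} [CStarAlgebra A] [Fintype ι]
    {E : ι → A} (hproj : ∀ j, IsSelfAdjoint (E j) ∧ E j * E j = E j)
    (horth : ∀ i j, i ≠ j → E i * E j = 0) (hsum : ∑ j, E j = 1)
    {c : ι → ℝ} {C : ℝ} (hC : 0 ≤ C) (hc : ∀ j, |c j| ≤ C) :
    ‖∑ j, c j • E j‖ ≤ C := by
  let : PartialOrder A := CStarAlgebra.spectralOrder A
  have : StarOrderedRing A := CStarAlgebra.spectralOrderedRing A
  have hE : ∀ j, 0 ≤ E j := fun j => by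
    have h := star_mul_self_nonneg (E j)
    rwa [(hproj j).1.star_eq, (hproj j).2] at h
  have hstar : star (∑ j, c j • E j) = ∑ j, c j • E j := by
    simp [star_sum, (hproj _).1.star_eq]
  have hmul := sum_smul_mul_sum_smul_of_orthogonal (fun j => (hproj j).2) horth c c
  have hnonneg : 0 ≤ ∑ j, (c j * c j) • E j :=
    Finset.sum_nonneg fun j _ => smul_nonneg (mul_self_nonneg _) (hE j)
  have hle : ∑ j, (c j * c j) • E j ≤ algebraMap ℝ A (C * C) := by
    rw [Algebra.algebraMap_eq_smul_one, ← hsum, Finset.smul_sum]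
    refine Finset.sum_le_sum fun j _ => smul_le_smul_of_nonneg_right ?_ (hE j)
    rw [← abs_mul_abs_self (c j)]
    exact mul_self_le_mul_self (abs_nonneg _) (hc j)
  have hnorm := (CStarAlgebra.norm_le_iff_le_algebraMap _ (mul_self_nonneg C) hnonneg).2 hle
  rw [← hmul] at hnorm
  nth_rewrite 1 [← hstar] at hnorm
  rw [CStarRing.norm_star_mul_self] at hnorm
  exact (mul_self_le_mul_self_iff (norm_nonneg _) hC).2 hnorm

/-- If `E_0, …, E_m` are pairwise orthogonal projections summing to `1`,
`λ_0 - λ_j ≥ a > 0` for all `j ≥ 1`, `H = Σ λ_j E_j` and `u` is a unitary, then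
`‖E_0 u (1 - E_0)‖ ≤ ‖Hu - uH‖ / a`; in particular `‖Hu - uH‖ < a` implies
`‖E_0 u (1 - E_0)‖ < 1`. -/
theorem corner_norm_le_commutator {A : Type*} [CStarAlgebra A]
    {m : ℕ} (E : Fin (m + 1) → A)
    (hproj : ∀ j, IsSelfAdjoint (E j) ∧ E j * E j = E j)
    (horth : ∀ i j, i ≠ j → E i * E j = 0)
    (hsum : ∑ j, E j = 1)
    (a : ℝ) (ha : 0 < a) (lam : Fin (m + 1) → ℝ)
    (hgap : ∀ j : Fin (m + 1), j ≠ 0 → a ≤ lam 0 - lam j)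
    (H : A) (hH : H = ∑ j, lam j • E j)
    (u : A) (hu : u ∈ unitary A) :
    ‖E 0 * u * (1 - E 0)‖ ≤ ‖H * u - u * H‖ / a ∧
    (‖H * u - u * H‖ < a → ‖E 0 * u * (1 - E 0)‖ < 1) := by
  have hidem := fun j => (hproj j).2
  set c : Fin (m + 1) → ℝ := fun j => if j = 0 then 0 else (lam 0 - lam j)⁻¹ with hc
  set R : A := ∑ j, c j • E j with hR
  have hRnorm : ‖R‖ ≤ a⁻¹ := by
    refine norm_sum_smul_le_of_orthogonal hproj horth hsum (inv_nonneg.2 ha.le) fun j => ?_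
    by_cases hj : j = 0
    · simp [hc, hj, ha.le]
    · have hg := hgap j hj
      simp only [hc, hj, if_false]
      rw [abs_of_nonneg (inv_nonneg.2 (ha.le.trans hg))]
      exact inv_anti₀ ha hg
  have hE0norm : ‖E 0‖ ≤ 1 := by
    have h := norm_sum_smul_le_of_orthogonal hproj horth hsum (c := Pi.single 0 1)
      zero_le_one fun j => by by_cases hj : j = 0 <;> simp [hj]
    simpa [Pi.single_apply] using h
  have hE0H : E 0 * H = lam 0 • E 0 := by
    rw [hH, Finset.mul_sum, Finset.sum_eq_single 0]
    · rw [mul_smul_comm, hidem]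
    · intro j _ hj
      rw [mul_smul_comm, horth 0 j hj.symm, smul_zero]
    · simp
  have hres : lam 0 • R - H * R = 1 - E 0 := by
    rw [hH, hR, sum_smul_mul_sum_smul_of_orthogonal hidem horth, Finset.smul_sum,
      ← Finset.sum_sub_distrib, ← hsum, Fin.sum_univ_succ, Fin.sum_univ_succ E]
    simp only [hc, if_true, mul_zero, zero_smul, smul_zero, sub_zero, zero_add,
      Fin.succ_ne_zero, if_false, add_sub_cancel_left]
    refine Finset.sum_congr rfl fun j _ => ?_
    have hg := hgap j.succ (Fin.succ_ne_zero j)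
    rw [smul_smul, ← sub_smul, ← sub_mul, mul_inv_cancel₀ (by linarith), one_smul]
  have hkey : E 0 * u * (1 - E 0) = E 0 * (H * u - u * H) * R := by
    rw [← hres, mul_sub (E 0), sub_mul, ← mul_assoc (E 0) H u, hE0H]
    simp only [mul_sub, mul_assoc, smul_mul_assoc, mul_smul_comm]
  have hmain : ‖E 0 * u * (1 - E 0)‖ ≤ ‖H * u - u * H‖ / a := by
    calc ‖E 0 * u * (1 - E 0)‖ = ‖E 0 * (H * u - u * H) * R‖ := by rw [hkey]
      _ ≤ ‖E 0‖ * ‖H * u - u * H‖ * ‖R‖ :=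
        (norm_mul_le _ _).trans (by gcongr; exact norm_mul_le _ _)
      _ ≤ 1 * ‖H * u - u * H‖ * a⁻¹ := by gcongr
      _ = ‖H * u - u * H‖ / a := by rw [one_mul, div_eq_mul_inv]
  exact ⟨hmain, fun h => hmain.trans_lt ((div_lt_one ha).2 h)⟩
end

section
/- Let S ⊆ ℝ be a nonempty compact set with at most n connected components and let d ≥ 0. Then the Lebesgue measure of the closed d-thickening {x ∈ ℝ : dist(x, S) ≤ d} is at most μ(S) + 2nd, where μ(S) is the Lebesgue measure of S. -/
open MeasureTheory

/-- The closed thickening of a compact subset of `ℝ` adds at most one interval of length `d` at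
either end of each connected component. -/
theorem Real.cthickening_subset_union_Icc {S : Set ℝ} (hS : IsCompact S) {C : Set (Set ℝ)}
    (hC : ∀ x ∈ S, connectedComponentIn S x ∈ C) {d : ℝ} (hd : 0 ≤ d) :
    Metric.cthickening d S ⊆
      S ∪ ⋃ K ∈ C, (Set.Icc (sInf K - d) (sInf K) ∪ Set.Icc (sSup K) (sSup K + d)) := by
  intro y hy
  rw [hS.cthickening_eq_biUnion_closedBall hd] at hy
  simp only [Set.mem_iUnion, Metric.mem_closedBall, Real.dist_eq, abs_le] at hy
  obtain ⟨s, hs, hys, hsy⟩ := hy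
  by_cases hyS : y ∈ S
  · exact Or.inl hyS
  right
  have hKS : connectedComponentIn S s ⊆ S := connectedComponentIn_subset S s
  have hsK : s ∈ connectedComponentIn S s := mem_connectedComponentIn hs
  have hord : (connectedComponentIn S s).OrdConnected :=
    isPreconnected_connectedComponentIn.ordConnected
  refine Set.mem_biUnion (hC s hs) ?_
  rcases le_total y s with h | h
  · left
    have h_inf : sInf (connectedComponentIn S s) ≤ s := csInf_le (hS.bddBelow.mono hKS) hsK
    refine ⟨by linarith, le_csInf ⟨s, hsK⟩ fun k hk => ?_⟩
    by_contra! hky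
    exact hyS (hKS (hord.out hk hsK ⟨hky.le, h⟩))
  · right
    have h_sup : s ≤ sSup (connectedComponentIn S s) := le_csSup (hS.bddAbove.mono hKS) hsK
    refine ⟨csSup_le ⟨s, hsK⟩ fun k hk => ?_, by linarith⟩
    by_contra! hky
    exact hyS (hKS (hord.out hsK hk ⟨h, hky.le⟩))

/-- If `S ⊆ ℝ` is nonempty, compact, and has at most `n` connected components, then the
Lebesgue measure of the closed `d`-thickening of `S` is at most `μ(S) + 2nd`. -/
theorem measure_cthickening_le {S : Set ℝ} (hne : S.Nonempty) (hcomp : IsCompact S)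
    (n : ℕ)
    (hcc : ∃ C : Finset (Set ℝ), C.card ≤ n ∧ ∀ x ∈ S, connectedComponentIn S x ∈ C)
    (d : ℝ) (hd : 0 ≤ d) :
    volume (Metric.cthickening d S) ≤ volume S + ENNReal.ofReal (2 * n * d) := by
  obtain ⟨C, hCn, hC⟩ := hcc
  have h_ends (K : Set ℝ) : volume (Set.Icc (sInf K - d) (sInf K) ∪
      Set.Icc (sSup K) (sSup K + d)) ≤ ENNReal.ofReal (2 * d) := by
    refine (measure_union_le _ _).trans_eq ?_
    rw [Real.volume_Icc, Real.volume_Icc, ← ENNReal.ofReal_add (by linarith) (by linarith)]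
    congr 1
    ring
  calc volume (Metric.cthickening d S)
      ≤ volume (S ∪ ⋃ K ∈ C, (Set.Icc (sInf K - d) (sInf K) ∪ Set.Icc (sSup K) (sSup K + d))) :=
        measure_mono (Real.cthickening_subset_union_Icc (C := C) hcomp hC hd)
    _ ≤ volume S + ∑ K ∈ C, volume (Set.Icc (sInf K - d) (sInf K) ∪
          Set.Icc (sSup K) (sSup K + d)) :=
        (measure_union_le _ _).trans (by gcongr; exact measure_biUnion_finset_le _ _)
    _ ≤ volume S + C.card • ENNReal.ofReal (2 * d) := by
        gcongr
        exact Finset.sum_le_card_nsmul _ _ _ fun K _ => h_ends K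
    _ ≤ volume S + ENNReal.ofReal (2 * n * d) := by
        rw [← ENNReal.ofReal_nsmul, nsmul_eq_mul, mul_left_comm, ← mul_assoc]
        gcongr
end

section
/- Let A be a unital C*-algebra, e ∈ A a projection, ε > 0, γ ∈ (0,1), and y ∈ A with y = e y (1−e) and ‖y‖ > ε. Then there exists a state φ on A (a ℂ-linear functional with φ(1) = 1 and φ(a*a) ≥ 0 for all a ∈ A) such that φ(e) = 1 − γ and φ(y + y*) is a real number greater than 2ε√(γ(1−γ)). -/
open scoped ComplexOrder

lemma norm_two_smul_sub_algebraMap_norm_le {A : Type*} [CStarAlgebra A] [PartialOrder A]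
    [StarOrderedRing A] {a : A} (ha : 0 ≤ a) :
    ‖(2 : ℝ) • a - algebraMap ℝ A ‖a‖‖ ≤ ‖a‖ := by
  nontriviality A
  have hsa : IsSelfAdjoint a := .of_nonneg ha
  have h : cfc (fun x : ℝ ↦ 2 * x - ‖a‖) a = (2 : ℝ) • a - algebraMap ℝ A ‖a‖ := by
    rw [cfc_sub (fun x : ℝ ↦ 2 * x) (fun _ ↦ ‖a‖) a, cfc_const_mul_id (2 : ℝ) a,
      cfc_const ‖a‖ a]
  rw [← h]
  refine norm_cfc_le (norm_nonneg a) fun x hx ↦ ?_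
  have h0 : 0 ≤ x := spectrum_nonneg_of_nonneg ha hx
  have h1 : x ≤ ‖a‖ := (Real.le_norm_self x).trans (spectrum.norm_le_norm_of_mem hx)
  rw [Real.norm_eq_abs, abs_le]
  constructor <;> linarith

/-- The hermitian part `a ↦ (f a + conj (f (star a))) / 2` of a linear functional `f`. -/
noncomputable def hermitianPart {A : Type*} [CStarAlgebra A] (f : A →ₗ[ℂ] ℂ) : A →ₗ[ℂ] ℂ where
  toFun a := (f a + star (f (star a))) / 2
  map_add' a b := by simp; ring
  map_smul' c a := by simp; ring

lemma hermitianPart_apply_of_isSelfAdjoint {A : Type*} [CStarAlgebra A] (f : A →ₗ[ℂ] ℂ) {a : A}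
    (ha : IsSelfAdjoint a) : hermitianPart f a = ((f a).re : ℂ) := by
  simp only [hermitianPart, LinearMap.coe_mk, AddHom.coe_mk, ha.star_eq]
  rw [Complex.re_eq_add_conj, Complex.star_def]

lemma exists_positiveLinearMap_apply_eq_norm {A : Type*} [CStarAlgebra A] [PartialOrder A]
    [StarOrderedRing A] {b : A} (hb : 0 ≤ b) (hb0 : b ≠ 0) :
    ∃ ω : A →ₚ[ℂ] ℂ, ω 1 = 1 ∧ ω b = ‖b‖ := by
  have hbpos : 0 < ‖b‖ := norm_pos_iff.2 hb0
  have : Nontrivial A := ⟨⟨b, 0, hb0⟩⟩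
  obtain ⟨f, hf, hfb⟩ := exists_dual_vector ℂ b hbpos.ne'
  have hle (a : A) : |(f a).re| ≤ ‖a‖ :=
    (Complex.abs_re_le_norm _).trans (by simpa [hf] using f.le_opNorm a)
  have hre (a : A) : (f ((2 : ℝ) • a - algebraMap ℝ A ‖a‖)).re
      = 2 * (f a).re - ‖a‖ * (f 1).re := by
    rw [Algebra.algebraMap_eq_smul_one, map_sub, ← Complex.coe_smul, ← Complex.coe_smul,
      map_smul, map_smul]
    simp
  have hf1 : (f 1).re = 1 := by
    have h1 := (abs_le.1 (hle 1)).2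
    have h2 := (abs_le.1 ((hle _).trans (norm_two_smul_sub_algebraMap_norm_le hb))).2
    rw [hre, hfb] at h2
    simp only [CStarRing.norm_one] at h1
    simp at h2
    nlinarith
  refine ⟨.mk₀ (hermitianPart f.toLinearMap) fun a ha ↦ ?_, ?_, ?_⟩
  · rw [hermitianPart_apply_of_isSelfAdjoint _ (.of_nonneg ha)]
    have h := (abs_le.1 ((hle _).trans (norm_two_smul_sub_algebraMap_norm_le ha))).1
    rw [hre, hf1] at h
    have h' : 0 ≤ (f a).re := by linarith
    exact_mod_cast h'
  · exact (hermitianPart_apply_of_isSelfAdjoint _ (.one A)).trans (by simp [hf1])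
  · exact (hermitianPart_apply_of_isSelfAdjoint _ (.of_nonneg hb)).trans (by simp [hfb])

/-- Given a projection `e`, `ε > 0`, `γ ∈ (0,1)` and `y = e y (1-e)` with `‖y‖ > ε`,
there is a state `φ` with `φ(e) = 1 - γ` and `φ(y + y*) > 2ε√(γ(1-γ))` (in particular
`φ(y + y*)` is real). -/
theorem exists_state_off_diagonal {A : Type*} [CStarAlgebra A]
    (e : A) (he : IsSelfAdjoint e) (he2 : e * e = e)
    (ε γ : ℝ) (hε : 0 < ε) (hγ : γ ∈ Set.Ioo (0 : ℝ) 1)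
    (y : A) (hy : y = e * y * (1 - e)) (hny : ε < ‖y‖) :
    ∃ φ : A →ₗ[ℂ] ℂ,
      φ 1 = 1 ∧
      (∀ a : A, 0 ≤ φ (star a * a)) ∧
      φ e = ((1 - γ : ℝ) : ℂ) ∧
      ((2 * ε * Real.sqrt (γ * (1 - γ)) : ℝ) : ℂ) < φ (y + star y) := by
  let _ := CStarAlgebra.spectralOrder A
  let _ := CStarAlgebra.spectralOrderedRing A
  obtain ⟨hγ0, hγ1⟩ := hγ
  have hc : 0 < ‖y‖ := hε.trans hny
  have hey : e * y = y := by rw [hy, ← mul_assoc, ← mul_assoc, he2]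
  have hye : y * e = 0 := by rw [hy, mul_assoc, sub_mul, one_mul, he2, sub_self, mul_zero]
  have hyy : y * y = 0 := by
    calc y * y = y * (e * y) := by rw [hey]
      _ = 0 := by rw [← mul_assoc, hye, zero_mul]
  have hse : star y * e = star y := by simpa [he.star_eq] using congrArg star hey
  have hes : e * star y = 0 := by simpa [he.star_eq] using congrArg star hye
  have hss : star y * star y = 0 := by simpa using congrArg star hyy
  have hb : 0 ≤ y * star y := mul_star_self_nonneg y
  have hbn : ‖y * star y‖ = ‖y‖ ^ 2 := by rw [CStarRing.norm_self_mul_star, sq]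
  obtain ⟨ω, hω1, hωb⟩ := exists_positiveLinearMap_apply_eq_norm hb
    (norm_pos_iff.1 (hbn ▸ by positivity))
  rw [hbn] at hωb
  have hsmul (r : ℝ) (a : A) : ω (r • a) = r * ω a := by
    rw [← Complex.coe_smul, map_smul, smul_eq_mul]
  have hωe : ω e = 1 := by
    apply le_antisymm
    · rw [← hω1]
      refine OrderHomClass.mono ω (sub_nonneg.1 ?_)
      have h : star (1 - e) * (1 - e) = 1 - e := by
        simp [he.star_eq, mul_sub, sub_mul, he2]
      exact h ▸ star_mul_self_nonneg (1 - e)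
    · have h := OrderHomClass.mono ω
        (CStarAlgebra.star_left_conjugate_le_norm_smul (a := e) (.of_nonneg hb))
      rw [he.star_eq, ← mul_assoc, hey, mul_assoc, hse, he2, hsmul, hωb, hbn] at h
      have hpos : (0 : ℂ) < ((‖y‖ ^ 2 : ℝ) : ℂ) := by exact_mod_cast pow_pos hc 2
      exact le_of_mul_le_mul_left (by simpa using h) hpos
  set s := √(1 - γ) with hs
  set u := √γ / ‖y‖ with hu
  have hs2 : s * s = 1 - γ := Real.mul_self_sqrt (by linarith)
  have hu2 : u * u * ‖y‖ ^ 2 = γ := by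
    rw [hu]; field_simp; exact Real.sq_sqrt hγ0.le
  set v := s • e + u • star y with hv
  have hvs : star v = s • e + u • y := by simp [hv, he.star_eq]
  have hv1 : star v * 1 * v = (s * s) • e + (u * u) • (y * star y) := by
    rw [hvs, hv]
    simp [mul_add, add_mul, he2, hes, hye, smul_smul]
  have hve : star v * e * v = (s * s) • e := by
    rw [hvs, hv]
    simp [mul_add, add_mul, he2, hes, hye, smul_smul]
  have hvy : star v * (y + star y) * v = (2 * (s * u)) • (y * star y) := by
    have h : star v * (y + star y) = s • y + u • (y * star y) := by
      rw [hvs]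
      simp [mul_add, add_mul, hey, hes, hyy]
    rw [h, hv]
    simp [mul_add, add_mul, hye, hse, hss, smul_smul, mul_assoc]
    module
  refine ⟨ω.toLinearMap ∘ₗ LinearMap.mulRight ℂ v ∘ₗ LinearMap.mulLeft ℂ (star v), ?_, fun a ↦ ?_,
    ?_, ?_⟩
  · change ω (star v * 1 * v) = 1
    rw [hv1, map_add, hsmul, hsmul, hωe, hωb, hs2, mul_one, ← Complex.ofReal_mul, hu2]
    simp
  · change 0 ≤ ω (star v * (star a * a) * v)
    have h : star v * (star a * a) * v = star (a * v) * (a * v) := by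
      simp [mul_assoc]
    exact h ▸ ω.map_nonneg (star_mul_self_nonneg _)
  · change ω (star v * e * v) = _
    rw [hve, hsmul, hωe, hs2, mul_one]
  · change _ < ω (star v * (y + star y) * v)
    rw [hvy, hsmul, hωb, ← Complex.ofReal_mul, Complex.real_lt_real, Real.sqrt_mul hγ0.le, ← hs]
    have h : 2 * (s * u) * ‖y‖ ^ 2 = 2 * ‖y‖ * (√γ * s) := by
      rw [hu]; field_simp
    rw [h]
    have : 0 < √γ * s := mul_pos (Real.sqrt_pos.2 hγ0) (Real.sqrt_pos.2 (by linarith))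
    gcongr
end

section
/- Let A be a unital C*-algebra, x ∈ A with ‖x‖ ≤ 1 and x*x ≥ (1−c)·1 for some c ∈ [0,1), and let e ∈ A be a projection. Then the positive element a = x e x* satisfies a² ≥ (1−c)·a; equivalently, a − a² ≤ c·a. -/
/-- If `‖x‖ ≤ 1`, `x* x ≥ (1-c) 1` with `c ∈ [0,1)`, and `e` is a projection, then
`a = x e x*` satisfies `a² ≥ (1-c) a`, equivalently `a - a² ≤ c a`. -/
theorem compress_almost_projection {A : Type*} [CStarAlgebra A]
    [PartialOrder A] [StarOrderedRing A]
    (x : A) (hx : ‖x‖ ≤ 1)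
    (c : ℝ) (hc0 : 0 ≤ c) (hc1 : c < 1)
    (hxx : (1 - c) • (1 : A) ≤ star x * x)
    (e : A) (he : IsSelfAdjoint e) (he2 : e * e = e) :
    (1 - c) • (x * e * star x) ≤ (x * e * star x) * (x * e * star x) ∧
    (x * e * star x) - (x * e * star x) * (x * e * star x) ≤ c • (x * e * star x) := by
  have key : (1 - c) • (x * e * star x) ≤ (x * e * star x) * (x * e * star x) := by
    have h := star_right_conjugate_le_conjugate hxx (x * e)
    have hl : x * e * ((1 - c) • (1 : A)) * star (x * e) = (1 - c) • (x * e * star x) := by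
      rw [mul_smul_comm, mul_one, smul_mul_assoc, star_mul, he.star_eq, ← mul_assoc,
        mul_assoc x e e, he2]
    have hr : x * e * (star x * x) * star (x * e) = (x * e * star x) * (x * e * star x) := by
      simp only [star_mul, he.star_eq, mul_assoc]
    rwa [hl, hr] at h
  refine ⟨key, ?_⟩
  rw [sub_smul, one_smul] at key
  exact sub_le_comm.mp key
end

section
/- Let A be a unital C*-algebra, δ > 0, and let e_0, e_1, …, e_N be pairwise orthogonal projections in A with Σ_{j=0}^{N} e_j = 1. Set k = Σ_{j=0}^{N} (2jδ) e_j, and let v ∈ A be a unitary such that v e_j v* ≤ e_{j−1} + e_j + e_{j+1} for every j (with the convention e_{−1} = 0 and e_{N+1} = 0). Then k − 2δ·1 ≤ v k v* ≤ k + 2δ·1, and in particular ‖v k v* − k‖ ≤ 2δ. -/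
section

open Finset

theorem IsStarProjection.sum {R ι : Type*} [NonUnitalSemiring R] [StarRing R]
    {e : ι → R} (he : ∀ i, IsStarProjection (e i)) (horth : ∀ i j, i ≠ j → e i * e j = 0)
    (s : Finset ι) : IsStarProjection (∑ i ∈ s, e i) := by
  classical
  refine ⟨?_, ?_⟩
  · rw [IsIdempotentElem, sum_mul_sum]
    refine sum_congr rfl fun i hi => ?_
    rw [sum_eq_single_of_mem i hi fun j _ hj => horth i j hj.symm]
    exact (he i).isIdempotentElem
  · exact isSelfAdjoint_sum _ fun i _ => (he i).isSelfAdjoint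

theorem sum_Icc_smul_eq_sum_sum_Icc {M : Type*} [AddCommGroup M] [Module ℝ M]
    (N : ℤ) (f : ℤ → M) :
    ∑ i ∈ Icc 0 N, (i : ℝ) • f i = ∑ t ∈ Icc 1 N, ∑ i ∈ Icc t N, f i := by
  rw [sum_comm' (s' := fun i => Icc 1 i) (t' := Icc 0 N)
    (fun t i => by simp only [mem_Icc]; omega)]
  refine sum_congr rfl fun i hi => ?_
  have hi' : ((i.toNat : ℕ) : ℝ) = (i : ℝ) := by
    exact_mod_cast Int.toNat_of_nonneg (mem_Icc.1 hi).1
  rw [sum_const, Int.card_Icc, ← Nat.cast_smul_eq_nsmul ℝ, add_sub_cancel_right, hi']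

variable {A : Type*} [CStarAlgebra A] [PartialOrder A] [StarOrderedRing A]

theorem IsStarProjection.mul_eq_zero_of_le_of_mul_eq_zero {e p q : A}
    (he : IsStarProjection e) (hp : IsStarProjection p) (hpq : p ≤ q) (heq : e * q = 0) :
    e * p = 0 := by
  have h1 : e * p * e ≤ 0 := by
    simpa [he.isSelfAdjoint.star_eq, heq] using star_right_conjugate_le_conjugate hpq e
  have h2 : 0 ≤ e * p * e := by
    simpa [he.isSelfAdjoint.star_eq] using star_right_conjugate_nonneg hp.nonneg e
  rw [← CStarRing.mul_star_self_eq_zero_iff, star_mul, hp.isSelfAdjoint.star_eq,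
    he.isSelfAdjoint.star_eq, mul_assoc, ← mul_assoc p, hp.isIdempotentElem.eq, ← mul_assoc]
  exact le_antisymm h1 h2

theorem sum_Icc_smul_le_add_one {N : ℕ} {e f : ℤ → A}
    (he : ∀ i, IsStarProjection (e i)) (hf : ∀ i, IsStarProjection (f i))
    (heorth : ∀ i j, i ≠ j → e i * e j = 0) (hforth : ∀ i j, i ≠ j → f i * f j = 0)
    (hesum : ∑ i ∈ Icc (0 : ℤ) N, e i = 1) (hef : ∀ i j, i + 1 < j → e i * f j = 0) :
    ∑ i ∈ Icc (0 : ℤ) N, (i : ℝ) • f i ≤ ∑ i ∈ Icc (0 : ℤ) N, (i : ℝ) • e i + 1 := by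
  have hP (t : ℤ) := IsStarProjection.sum he heorth (Icc t N)
  have hQ (t : ℤ) := IsStarProjection.sum hf hforth (Icc t N)
  have hshift : ∑ t ∈ Icc (1 : ℤ) (N + 1), ∑ i ∈ Icc (t - 1) (N : ℤ), e i
      = ∑ t ∈ Icc (0 : ℤ) N, ∑ i ∈ Icc t (N : ℤ), e i :=
    sum_nbij' (· - 1) (· + 1) (by simp) (by simp) (by simp) (by simp) (by simp)
  have hhead : ∑ t ∈ Icc (0 : ℤ) N, ∑ i ∈ Icc t (N : ℤ), e i
      = 1 + ∑ t ∈ Icc (1 : ℤ) N, ∑ i ∈ Icc t (N : ℤ), e i := by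
    have hins : Icc (0 : ℤ) N = insert 0 (Icc 1 (N : ℤ)) := by
      ext t; simp only [mem_insert, mem_Icc]; omega
    rw [← hesum, ← sum_insert (f := fun t => ∑ i ∈ Icc t (N : ℤ), e i) (by simp), ← hins]
  rw [sum_Icc_smul_eq_sum_sum_Icc, sum_Icc_smul_eq_sum_sum_Icc, add_comm, ← hhead, ← hshift]
  refine (sum_le_sum fun t ht => ?_).trans <| sum_le_sum_of_subset_of_nonneg
    (Icc_subset_Icc_right (by omega)) fun t _ _ => (hP (t - 1)).nonneg
  rw [(hQ t).le_iff_mul_eq_right (hP (t - 1))]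
  have hsplit : ∑ i ∈ Ico (0 : ℤ) (t - 1), e i + ∑ i ∈ Icc (t - 1) (N : ℤ), e i = 1 := by
    rw [← hesum, ← sum_union]
    · congr 1
      ext i
      simp only [mem_Icc, mem_Ico, mem_union] at ht ⊢
      omega
    · exact disjoint_left.2 fun i => by simp only [mem_Icc, mem_Ico]; omega
  rw [eq_sub_of_add_eq' hsplit, sub_mul, one_mul, sum_mul_sum,
    sum_eq_zero fun i hi => sum_eq_zero fun j hj => hef i j ?_, sub_zero]
  simp only [mem_Icc, mem_Ico] at hi hj
  omega

theorem IsSelfAdjoint.norm_le_of_neg_algebraMap_le_of_le_algebraMap {x : A}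
    (hx : IsSelfAdjoint x) {r : ℝ} (hr : 0 ≤ r) (hl : -algebraMap ℝ A r ≤ x)
    (hu : x ≤ algebraMap ℝ A r) : ‖x‖ ≤ r := by
  rcases subsingleton_or_nontrivial A with _ | _
  · rwa [Subsingleton.elim x 0, norm_zero]
  rw [← map_neg, algebraMap_le_iff_le_spectrum] at hl
  rw [le_algebraMap_iff_spectrum_le] at hu
  rcases CStarAlgebra.norm_or_neg_norm_mem_spectrum hx with h | h
  · exact hu _ h
  · linarith [hl _ h]

end

/-- If `e_0, …, e_N` are pairwise orthogonal projections summing to `1` (extended by `0`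
for indices outside `{0, …, N}`), `k = Σ_j (2jδ) e_j`, and `v` is a unitary with
`v e_j v* ≤ e_{j-1} + e_j + e_{j+1}` for all `j`, then
`k - 2δ ≤ v k v* ≤ k + 2δ`, and in particular `‖v k v* - k‖ ≤ 2δ`. -/
theorem conj_tridiagonal_estimate {A : Type*} [CStarAlgebra A]
    [PartialOrder A] [StarOrderedRing A]
    (δ : ℝ) (hδ : 0 < δ) (N : ℕ)
    (e : ℤ → A)
    (hzero : ∀ j : ℤ, j < 0 ∨ (N : ℤ) < j → e j = 0)
    (hproj : ∀ j, IsSelfAdjoint (e j) ∧ e j * e j = e j)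
    (horth : ∀ i j, i ≠ j → e i * e j = 0)
    (hsum : ∑ j ∈ Finset.Icc (0 : ℤ) (N : ℤ), e j = 1)
    (k : A) (hk : k = ∑ j ∈ Finset.Icc (0 : ℤ) (N : ℤ), (2 * (j : ℝ) * δ) • e j)
    (v : A) (hv : v ∈ unitary A)
    (hconj : ∀ j : ℤ, v * e j * star v ≤ e (j - 1) + e j + e (j + 1)) :
    k - (2 * δ) • (1 : A) ≤ v * k * star v ∧
    v * k * star v ≤ k + (2 * δ) • (1 : A) ∧
    ‖v * k * star v - k‖ ≤ 2 * δ := by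
  have he (j : ℤ) : IsStarProjection (e j) := ⟨(hproj j).2, (hproj j).1⟩
  have hvv : star v * v = 1 := Unitary.star_mul_self_of_mem hv
  have hvv' : v * star v = 1 := Unitary.mul_star_self_of_mem hv
  have hmul (a b : A) : v * a * star v * (v * b * star v) = v * (a * b) * star v := by
    rw [show v * a * star v * (v * b * star v) = v * a * (star v * v) * b * star v by
      simp only [mul_assoc], hvv, mul_one, mul_assoc v a b]
  let f : ℤ → A := fun j => v * e j * star v
  have hf (j : ℤ) : IsStarProjection (f j) :=
    ⟨by rw [IsIdempotentElem, hmul, (hproj j).2], (hproj j).1.conjugate v⟩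
  have hforth (i j : ℤ) (hij : i ≠ j) : f i * f j = 0 := by
    rw [hmul, horth i j hij, mul_zero, zero_mul]
  have hfsum : ∑ j ∈ Finset.Icc (0 : ℤ) (N : ℤ), f j = 1 := by
    rw [← Finset.sum_mul, ← Finset.mul_sum, hsum, mul_one, hvv']
  have hef (i j : ℤ) (h : i + 1 < j ∨ j + 1 < i) : e i * f j = 0 := by
    refine (he i).mul_eq_zero_of_le_of_mul_eq_zero (hf j) (hconj j) ?_
    rw [mul_add, mul_add, horth _ _ (by omega), horth _ _ (by omega), horth _ _ (by omega)]
    simp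
  have hfe (i j : ℤ) (h : i + 1 < j) : f i * e j = 0 := by
    have := congrArg star (hef j i (Or.inr h))
    rwa [star_mul, (he j).isSelfAdjoint.star_eq, (hf i).isSelfAdjoint.star_eq, star_zero] at this
  have hupper := sum_Icc_smul_le_add_one he hf horth hforth hsum fun i j h => hef i j (Or.inl h)
  have hlower := sum_Icc_smul_le_add_one hf he hforth horth hfsum hfe
  have hk' : k = (2 * δ) • ∑ j ∈ Finset.Icc (0 : ℤ) (N : ℤ), (j : ℝ) • e j := by
    rw [hk, Finset.smul_sum]
    exact Finset.sum_congr rfl fun j _ => by rw [smul_smul]; ring_nf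
  have hvk : v * k * star v = (2 * δ) • ∑ j ∈ Finset.Icc (0 : ℤ) (N : ℤ), (j : ℝ) • f j := by
    simp only [hk', f, mul_smul_comm, smul_mul_assoc, Finset.mul_sum, Finset.sum_mul]
  have hδ' : 0 ≤ 2 * δ := by positivity
  have hu : v * k * star v ≤ k + (2 * δ) • (1 : A) := by
    rw [hvk, hk', ← smul_add]
    exact smul_le_smul_of_nonneg_left hupper hδ'
  have hl : k - (2 * δ) • (1 : A) ≤ v * k * star v := by
    rw [sub_le_iff_le_add, hvk, hk', ← smul_add]
    exact smul_le_smul_of_nonneg_left hlower hδ'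
  have hksa : IsSelfAdjoint k := by
    rw [hk]
    exact isSelfAdjoint_sum _ fun j _ => (IsSelfAdjoint.all _).smul (hproj j).1
  refine ⟨hl, hu, ?_⟩
  refine ((hksa.conjugate v).sub hksa).norm_le_of_neg_algebraMap_le_of_le_algebraMap hδ' ?_ ?_
  · rw [Algebra.algebraMap_eq_smul_one, le_sub_iff_add_le, neg_add_eq_sub]
    exact hl
  · rw [Algebra.algebraMap_eq_smul_one, sub_le_iff_le_add']
    exact hu
end

section
/- Let A be a unital C*-algebra, c ∈ [0,1), and y ∈ A with ‖1 − y*y‖ ≤ c and ‖1 − yy*‖ ≤ c. Then y is invertible, and there exists a unitary v ∈ A (namely v = y (y*y)^{−1/2}) such that v (y*y)^{1/2} = y and ‖v − y‖ ≤ (1−c)^{−1/2} − 1. -/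
/-- A ring element that is both left and right invertible up to a small error is a unit. -/
theorem isUnit_of_norm_one_sub_mul_lt {R : Type*} [NormedRing R] [HasSummableGeomSeries R]
    {x y z : R} (hl : ‖1 - z * y‖ < 1) (hr : ‖1 - y * x‖ < 1) : IsUnit y := by
  have hu : IsUnit (z * y) := by simpa using isUnit_one_sub_of_norm_lt_one hl
  have hw : IsUnit (y * x) := by simpa using isUnit_one_sub_of_norm_lt_one hr
  obtain ⟨b, hb⟩ := hu.exists_left_inv
  obtain ⟨d, hd⟩ := hw.exists_right_inv
  rw [← mul_assoc] at hb
  rw [mul_assoc] at hd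
  exact isUnit_iff_exists_and_exists.2 ⟨⟨x * d, hd⟩, ⟨b * z, hb⟩⟩

theorem abs_one_sub_sqrt_le {c t : ℝ} (hc : c < 1) (ht : |1 - t| ≤ c) :
    |1 - √t| ≤ 1 / √(1 - c) - 1 := by
  obtain ⟨h1, h2⟩ := abs_le.1 ht
  have hr : 0 < √(1 - c) := Real.sqrt_pos.2 (by linarith)
  have hrr : √(1 - c) ^ 2 = 1 - c := Real.sq_sqrt (by linarith)
  have hut : √t ^ 2 = t := Real.sq_sqrt (by linarith)
  have hru : √(1 - c) ≤ √t := Real.sqrt_le_sqrt (by linarith)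
  have hupper : √t ≤ 1 / √(1 - c) := by
    rw [le_div_iff₀ hr]
    nlinarith [sq_nonneg (√t - √(1 - c))]
  have hlower : 2 - √(1 - c) ≤ 1 / √(1 - c) := by
    rw [le_div_iff₀ hr]
    nlinarith [sq_nonneg (√(1 - c) - 1)]
  rw [abs_le]
  constructor <;> linarith

theorem norm_one_sub_sqrt_le {A : Type*} [CStarAlgebra A] [PartialOrder A] [StarOrderedRing A]
    {c : ℝ} (hc0 : 0 ≤ c) (hc1 : c < 1) {a : A} (ha : 0 ≤ a) (h : ‖1 - a‖ ≤ c) :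
    ‖1 - CFC.sqrt a‖ ≤ 1 / √(1 - c) - 1 := by
  have hbound : 0 ≤ 1 / √(1 - c) - 1 :=
    (abs_nonneg _).trans (abs_one_sub_sqrt_le (t := 1) hc1 (by simpa using hc0))
  cases subsingleton_or_nontrivial A
  · simpa [Subsingleton.elim (1 - CFC.sqrt a) 0] using hbound
  have hs : 1 - CFC.sqrt a = cfc (fun t : ℝ => 1 - √t) a := by
    rw [cfc_sub (fun _ : ℝ => (1 : ℝ)) Real.sqrt a, cfc_const_one ℝ a,
      CFC.sqrt_eq_real_sqrt a, cfcₙ_eq_cfc]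
  rw [hs]
  refine norm_cfc_le hbound fun t ht => abs_one_sub_sqrt_le hc1 ?_
  have hmem : 1 - t ∈ spectrum ℝ (1 - a) := by
    have := spectrum.singleton_sub_eq a (1 : ℝ)
    rw [map_one] at this
    rw [← this]
    exact Set.sub_mem_sub rfl ht
  exact (spectrum.norm_le_norm_of_mem hmem).trans h

/-- If `‖1 - y* y‖ ≤ c` and `‖1 - y y*‖ ≤ c` with `c ∈ [0,1)`, then `y` is invertible
and the unitary `v = y (y* y)^{-1/2}` from the polar decomposition satisfies
`v (y* y)^{1/2} = y` and `‖v - y‖ ≤ (1-c)^{-1/2} - 1`. -/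
theorem polar_unitary_close {A : Type*} [CStarAlgebra A]
    [PartialOrder A] [StarOrderedRing A]
    (c : ℝ) (hc0 : 0 ≤ c) (hc1 : c < 1)
    (y : A) (h1 : ‖1 - star y * y‖ ≤ c) (h2 : ‖1 - y * star y‖ ≤ c) :
    IsUnit y ∧
    ∃ v ∈ unitary A,
      v * CFC.sqrt (star y * y) = y ∧
      ‖v - y‖ ≤ 1 / Real.sqrt (1 - c) - 1 := by
  have hy : IsUnit y := isUnit_of_norm_one_sub_mul_lt (h1.trans_lt hc1) (h2.trans_lt hc1)
  have ha : 0 ≤ star y * y := star_mul_self_nonneg y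
  have hs : IsUnit (CFC.sqrt (star y * y)) := (CFC.isUnit_sqrt_iff _ ha).2 (hy.star.mul hy)
  have hss := CFC.sqrt_mul_sqrt_self _ ha
  have hsa : star (CFC.sqrt (star y * y)) = CFC.sqrt (star y * y) :=
    (CFC.sqrt_nonneg _).isSelfAdjoint
  have hle := norm_one_sub_sqrt_le hc0 hc1 ha h1
  obtain ⟨s, hs⟩ := hs
  rw [← hs] at hss hsa hle ⊢
  have hsi : star (↑s⁻¹ : A) = ↑s⁻¹ := by
    rw [← Units.coe_star_inv, show star s = s from Units.ext hsa]
  have hvs : y * ↑s⁻¹ * ↑s = y := Units.inv_mul_cancel_right y s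
  have hv : star (y * ↑s⁻¹) * (y * ↑s⁻¹) = 1 := by
    rw [star_mul, hsi, mul_assoc, ← mul_assoc (star y), ← hss]
    simp [mul_assoc]
  have hmem : y * ↑s⁻¹ ∈ unitary A :=
    (hy.mul s⁻¹.isUnit).mem_unitary_of_star_mul_self hv
  refine ⟨hy, _, hmem, hvs, ?_⟩
  calc ‖y * ↑s⁻¹ - y‖ = ‖y * ↑s⁻¹ * (1 - ↑s)‖ := by rw [mul_sub, mul_one, hvs]
    _ = ‖(1 : A) - ↑s‖ := CStarRing.norm_mem_unitary_mul _ hmem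
    _ ≤ 1 / √(1 - c) - 1 := hle
end
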